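/- Let Ω be an open set of finite Lebesgue measure in ℝⁿ, n ≥ 2, let m ∈ ℕ with m < n, and let d ∈ (0, n−m); set α = (n−d)/m. Let ‖·‖_X and ‖·‖_Z be rearrangement-invariant function norms on (0,1), and let μ be a finite Borel measure on Ω with sup_{x ∈ ℝⁿ, r > 0} μ(B_r(x) ∩ Ω)/r^d < ∞. For f measurable nonnegative on (0,1), set S₁f(t) = ∫_{t^{n/d}}^1 f(s) s^{−1+m/n} ds and S₂f(t) = t^{−m/(n−d)} ∫₀^{t^{n/d}} f(s) s^{−1+m/(n−d)} ds. Assume there is a constant C₁ such that, for every nonnegative non-increasing measurable f on (0,1), both ‖ (S₁f)^α ‖_Z^{1/α} ≤ C₁ ‖f‖_X and ‖ ( (S₁f)^{1/α} (S₂f)^{1−1/α} )^α ‖_Z^{1/α} ≤ C₁ ‖f‖_X. Then there exists a constant C₂ such that for every u ∈ C_c^∞(Ω): ‖ ( u*_μ(μ(Ω)·t) )^α ‖_Z^{1/α} ≤ C₂ ‖ t ↦ (|∇^m u|)*(|Ω|·t) ‖_X. -/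

import Mathlib

open MeasureTheory Set
open scoped ENNReal NNReal

/-- Lebesgue measure on the interval `(0,1)`. -/
noncomputable def vol01 : MeasureTheory.Measure ℝ :=
  MeasureTheory.volume.restrict (Set.Ioo 0 1)

/-- The non-increasing rearrangement on `(0,1)` of an extended-nonnegative function. -/
noncomputable def decRearr (f : ℝ → ℝ≥0∞) (s : ℝ) : ℝ≥0∞ :=
  sInf {ρ : ℝ≥0∞ | vol01 {t | ρ < f t} ≤ ENNReal.ofReal s}

/-- The non-increasing rearrangement of a real-valued function with respect to a measure. -/
noncomputable def rearr {α : Type*} [MeasurableSpace α] (ν : MeasureTheory.Measure α)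
    (u : α → ℝ) (s : ℝ) : ℝ≥0∞ :=
  sInf {ρ : ℝ≥0∞ | ν {x | ρ < ENNReal.ofReal |u x|} ≤ ENNReal.ofReal s}

/-- A rearrangement-invariant function norm on `(0,1)`: properties (P1)–(P6). -/
structure IsRINorm (N : (ℝ → ℝ≥0∞) → ℝ≥0∞) : Prop where
  eq_zero_iff : ∀ f : ℝ → ℝ≥0∞, N f = 0 ↔ (∀ᵐ t ∂vol01, f t = 0)
  smul : ∀ (c : ℝ≥0) (f : ℝ → ℝ≥0∞), N (fun t => (c : ℝ≥0∞) * f t) = (c : ℝ≥0∞) * N f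
  add_le : ∀ f g : ℝ → ℝ≥0∞, N (fun t => f t + g t) ≤ N f + N g
  mono : ∀ f g : ℝ → ℝ≥0∞, (∀ᵐ t ∂vol01, f t ≤ g t) → N f ≤ N g
  iSup_eq : ∀ (f : ℕ → ℝ → ℝ≥0∞) (g : ℝ → ℝ≥0∞),
    (∀ k, ∀ᵐ t ∂vol01, f k t ≤ f (k + 1) t) →
    (∀ᵐ t ∂vol01, (⨆ k, f k t) = g t) → N g = ⨆ k, N (f k)
  indicator_lt_top : ∀ E : Set ℝ, MeasurableSet E → E ⊆ Set.Ioo 0 1 → N (E.indicator 1) < ⊤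
  exists_integral_le : ∀ E : Set ℝ, MeasurableSet E → E ⊆ Set.Ioo 0 1 →
    ∃ C : ℝ≥0, ∀ f : ℝ → ℝ≥0∞, (∫⁻ t in E, f t) ≤ (C : ℝ≥0∞) * N f
  rearr_invariant : ∀ f g : ℝ → ℝ≥0∞, decRearr f = decRearr g → N f = N g

/-- The Hardy-type operator `S₁f(t) = ∫_{t^{n/d}}^1 f(s) s^{-1+m/n} ds`. -/
noncomputable def S1 (n m : ℕ) (d : ℝ) (f : ℝ → ℝ≥0∞) (t : ℝ) : ℝ≥0∞ :=
  ∫⁻ s in Set.Ioo (t ^ ((n : ℝ) / d)) 1, ENNReal.ofReal (s ^ ((m : ℝ) / n - 1)) * f s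

/-- The Hardy-type operator
`S₂f(t) = t^{-m/(n-d)} ∫_0^{t^{n/d}} f(s) s^{-1+m/(n-d)} ds`. -/
noncomputable def S2 (n m : ℕ) (d : ℝ) (f : ℝ → ℝ≥0∞) (t : ℝ) : ℝ≥0∞ :=
  ENNReal.ofReal (t ^ (-((m : ℝ) / ((n : ℝ) - d)))) *
    ∫⁻ s in Set.Ioo (0 : ℝ) (t ^ ((n : ℝ) / d)),
      ENNReal.ofReal (s ^ ((m : ℝ) / ((n : ℝ) - d) - 1)) * f s

theorem lintegral_Ioo_rpow {p a b : ℝ} (hp : 0 < p) (ha : 0 ≤ a) (hab : a ≤ b) :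
    ∫⁻ s in Ioo a b, ENNReal.ofReal (s ^ (p - 1)) = ENNReal.ofReal ((b ^ p - a ^ p) / p) := by
  have hint : IntervalIntegrable (fun s : ℝ => s ^ (p - 1)) volume a b :=
    intervalIntegral.intervalIntegrable_rpow' (by linarith)
  rw [restrict_Ioo_eq_restrict_Ioc, ← ofReal_integral_eq_lintegral_ofReal,
    ← intervalIntegral.integral_of_le hab, integral_rpow (Or.inl (by linarith))]
  · simp
  · exact (intervalIntegrable_iff_integrableOn_Ioc_of_le hab).1 hint
  · filter_upwards [ae_restrict_mem measurableSet_Ioc] with s hs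
    exact Real.rpow_nonneg (ha.trans hs.1.le) _

theorem lintegral_Ioi_rpow {p R : ℝ} (hp : 0 < p) (hR : 0 < R) :
    ∫⁻ s in Ioi R, ENNReal.ofReal (s ^ (-p - 1)) = ENNReal.ofReal (R ^ (-p) / p) := by
  rw [← ofReal_integral_eq_lintegral_ofReal, integral_Ioi_rpow_of_lt (by linarith) hR]
  · congr 1
    rw [sub_add_cancel, neg_div_neg_eq]
  · exact integrableOn_Ioi_rpow_of_lt (by linarith) hR
  · filter_upwards [ae_restrict_mem measurableSet_Ioi] with s hs
    exact Real.rpow_nonneg (hR.trans hs).le _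

section Potential

variable {E : Type*} [NormedAddCommGroup E] [NormedSpace ℝ E]

/-- The trace of `‖D^k u‖` on the ray from `x` in direction `w` is bounded by the integral of the
trace of `‖D^(k+1) u‖` over the rest of the ray. -/
theorem enorm_iteratedFDeriv_ray_le {u : E → ℝ} (hu : ContDiff ℝ (⊤ : ℕ∞) u)
    (hc : HasCompactSupport u) (x w : E) (hw0 : w ≠ 0) (hw : ‖w‖ ≤ 1) (k : ℕ) (r : ℝ) :
    ‖iteratedFDeriv ℝ k u (x + r • w)‖ₑ ≤
      ∫⁻ q in Ioi r, ‖iteratedFDeriv ℝ (k + 1) u (x + q • w)‖ₑ := by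
  set γ : ℝ → E := fun q => x + q • w with hγ
  have hγc : Topology.IsClosedEmbedding γ :=
    (Homeomorph.addLeft x).isClosedEmbedding.comp (isClosedEmbedding_smul_left hw0)
  have hγd : ∀ q, HasDerivAt γ w q := fun q => by
    have := ((hasDerivAt_id q).smul_const w).const_add x
    rwa [one_smul] at this
  have hk : ContDiff ℝ 1 (iteratedFDeriv ℝ k u) :=
    hu.iteratedFDeriv_right (by exact_mod_cast le_top)
  have hγs : ContDiff ℝ 1 γ := by
    rw [hγ]; fun_prop
  have h1 : ContDiff ℝ 1 (fun q => iteratedFDeriv ℝ k u (γ q)) := hk.comp hγs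
  have h2 : HasCompactSupport (fun q => iteratedFDeriv ℝ k u (γ q)) :=
    (hc.iteratedFDeriv (𝕜 := ℝ) k).comp_isClosedEmbedding hγc
  have h3 := h2.integral_Ioi_deriv_eq h1 r
  have h4 : ‖iteratedFDeriv ℝ k u (γ r)‖ₑ
      = ‖∫ q in Ioi r, deriv (fun q => iteratedFDeriv ℝ k u (γ q)) q‖ₑ := by
    rw [h3, enorm_neg]
  change ‖iteratedFDeriv ℝ k u (γ r)‖ₑ ≤ _
  rw [h4]
  refine (enorm_integral_le_lintegral_enorm _).trans (lintegral_mono fun q => ?_)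
  have h5 : HasDerivAt (fun q => iteratedFDeriv ℝ k u (γ q))
      (fderiv ℝ (iteratedFDeriv ℝ k u) (γ q) w) q :=
    ((hk.differentiable one_ne_zero (γ q)).hasFDerivAt).comp_hasDerivAt q (hγd q)
  rw [h5.deriv]
  have h6 : ‖fderiv ℝ (iteratedFDeriv ℝ k u) (γ q) w‖ ≤ ‖iteratedFDeriv ℝ (k + 1) u (γ q)‖ := by
    rw [← norm_fderiv_iteratedFDeriv]
    refine (ContinuousLinearMap.le_opNorm _ _).trans ?_
    exact mul_le_of_le_one_right (norm_nonneg _) hw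
  exact enorm_le_iff_norm_le.2 h6

theorem enorm_le_lintegral_ray {u : E → ℝ} (hu : ContDiff ℝ (⊤ : ℕ∞) u)
    (hc : HasCompactSupport u) (x w : E) (hw0 : w ≠ 0) (hw : ‖w‖ ≤ 1) (k : ℕ) :
    ‖u x‖ₑ ≤ ∫⁻ r in Ioi (0 : ℝ),
      ENNReal.ofReal (r ^ k) * ‖iteratedFDeriv ℝ (k + 1) u (x + r • w)‖ₑ := by
  have hmeas : ∀ j : ℕ, Measurable fun q : ℝ => ‖iteratedFDeriv ℝ j u (x + q • w)‖ₑ := by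
    intro j
    have : Continuous (iteratedFDeriv ℝ j u) := hu.continuous_iteratedFDeriv (by exact_mod_cast le_top)
    have : Continuous fun q : ℝ => iteratedFDeriv ℝ j u (x + q • w) := by fun_prop
    exact this.enorm.measurable
  induction k with
  | zero =>
    have := enorm_iteratedFDeriv_ray_le hu hc x w hw0 hw 0 0
    simp only [pow_zero, ENNReal.ofReal_one, one_mul]
    refine le_trans (le_of_eq ?_) this
    rw [zero_smul, add_zero, enorm_eq_iff_norm_eq, norm_iteratedFDeriv_zero]
  | succ k ih =>
    refine ih.trans ?_
    set φ : ℝ → ℝ≥0∞ := fun q => ‖iteratedFDeriv ℝ (k + 1 + 1) u (x + q • w)‖ₑ with hφ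
    have hφm : Measurable φ := hmeas _
    calc ∫⁻ r in Ioi (0 : ℝ), ENNReal.ofReal (r ^ k) * ‖iteratedFDeriv ℝ (k + 1) u (x + r • w)‖ₑ
        ≤ ∫⁻ r in Ioi (0 : ℝ), ∫⁻ q in Ioi (0 : ℝ),
            (Ioo 0 q).indicator (fun r => ENNReal.ofReal (r ^ k)) r * φ q := by
          refine setLIntegral_mono' measurableSet_Ioi fun r hr => ?_
          have hr' : (0 : ℝ) < r := hr
          refine (mul_le_mul_right (enorm_iteratedFDeriv_ray_le hu hc x w hw0 hw (k + 1) r) _).trans ?_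
          rw [← lintegral_const_mul _ hφm, ← lintegral_indicator measurableSet_Ioi,
            ← lintegral_indicator measurableSet_Ioi]
          refine lintegral_mono fun q => ?_
          by_cases hq : r < q
          · simp [indicator, hr', hq, hr'.trans hq, hφ]
          · simp [indicator, hq]
      _ = ∫⁻ q in Ioi (0 : ℝ), ∫⁻ r in Ioi (0 : ℝ),
            (Ioo 0 q).indicator (fun r => ENNReal.ofReal (r ^ k)) r * φ q := by
          refine lintegral_lintegral_swap (Measurable.aemeasurable ?_)
          refine Measurable.mul ?_ (hφm.comp measurable_snd)
          have : MeasurableSet {p : ℝ × ℝ | 0 < p.1 ∧ p.1 < p.2} :=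
            (measurableSet_lt measurable_const measurable_fst).inter
              (measurableSet_lt measurable_fst measurable_snd)
          have h2 : Measurable fun p : ℝ × ℝ => ENNReal.ofReal (p.1 ^ k) := by fun_prop
          exact h2.indicator this
      _ ≤ ∫⁻ q in Ioi (0 : ℝ), ENNReal.ofReal (q ^ (k + 1)) * φ q := by
          refine setLIntegral_mono' measurableSet_Ioi fun q hq => ?_
          have hq' : (0 : ℝ) < q := hq
          rw [lintegral_mul_const _
            ((by fun_prop : Measurable fun r : ℝ => ENNReal.ofReal (r ^ k)).indicator
              measurableSet_Ioo)]
          gcongr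
          calc ∫⁻ r in Ioi (0 : ℝ), (Ioo 0 q).indicator (fun r => ENNReal.ofReal (r ^ k)) r
              ≤ ∫⁻ r, (Ioo 0 q).indicator (fun _ => ENNReal.ofReal (q ^ k)) r := by
                refine (setLIntegral_le_lintegral _ _).trans (lintegral_mono fun r => ?_)
                refine indicator_le_indicator' fun hr => ENNReal.ofReal_le_ofReal ?_
                exact pow_le_pow_left₀ hr.1.le hr.2.le k
            _ = ENNReal.ofReal (q ^ (k + 1)) := by
                rw [lintegral_indicator measurableSet_Ioo, setLIntegral_const, Real.volume_Ioo,
                  sub_zero, ← ENNReal.ofReal_mul (by positivity), pow_succ]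

end Potential

/-- The truncated Riesz-type potential of a function, written through its integrals on balls. -/
noncomputable def ballPotential {n : ℕ} (m : ℕ) (g : EuclideanSpace ℝ (Fin n) → ℝ≥0∞)
    (x : EuclideanSpace ℝ (Fin n)) : ℝ≥0∞ :=
  ∫⁻ r in Ioi (0 : ℝ), ENNReal.ofReal (r ^ ((m : ℝ) - n - 1)) * ∫⁻ y in Metric.ball x r, g y

theorem lintegral_unitBall_comp_add_smul {n : ℕ} {g : EuclideanSpace ℝ (Fin n) → ℝ≥0∞}
    (hg : Measurable g) (x : EuclideanSpace ℝ (Fin n)) {r : ℝ} (hr : 0 < r) :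
    ∫⁻ w in Metric.ball 0 1, g (x + r • w) =
      ENNReal.ofReal (r ^ (-(n : ℝ))) * ∫⁻ y in Metric.ball x r, g y := by
  have h1 : ∫⁻ w in Metric.ball (0 : EuclideanSpace ℝ (Fin n)) 1, g (x + r • w)
      = ∫⁻ w, (Metric.ball x r).indicator g (x + r • w) := by
    rw [← lintegral_indicator Metric.isOpen_ball.measurableSet]
    congr 1 with w
    have : w ∈ Metric.ball (0 : EuclideanSpace ℝ (Fin n)) 1 ↔ x + r • w ∈ Metric.ball x r := by
      simp [norm_smul, abs_of_pos hr, hr]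
    by_cases h : w ∈ Metric.ball (0 : EuclideanSpace ℝ (Fin n)) 1
    · rw [indicator_of_mem h, indicator_of_mem (this.1 h)]
    · rw [indicator_of_notMem h, indicator_of_notMem (fun h' => h (this.2 h'))]
  have hm : Measurable fun z => (Metric.ball x r).indicator g (x + z) :=
    (hg.indicator Metric.isOpen_ball.measurableSet).comp (measurable_const_add x)
  have h2 : ∫⁻ w, (Metric.ball x r).indicator g (x + r • w)
      = ∫⁻ z, (Metric.ball x r).indicator g (x + z)
          ∂(Measure.map (fun w : EuclideanSpace ℝ (Fin n) => r • w) volume) :=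
    (lintegral_map hm (measurable_const_smul r)).symm
  rw [h1, h2, Measure.map_addHaar_smul _ hr.ne', lintegral_smul_measure,
    lintegral_add_left_eq_self, lintegral_indicator Metric.isOpen_ball.measurableSet, smul_eq_mul]
  congr 2
  rw [abs_of_nonneg (by positivity), finrank_euclideanSpace_fin, Real.rpow_neg hr.le,
    Real.rpow_natCast]

theorem enorm_le_ballPotential (n m : ℕ) (hm : 1 ≤ m) (hn : 2 ≤ n) :
    ∃ C : ℝ≥0, ∀ u : EuclideanSpace ℝ (Fin n) → ℝ, ContDiff ℝ (⊤ : ℕ∞) u → HasCompactSupport u →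
      ∀ x, ‖u x‖ₑ ≤ C * ballPotential m (fun y => ‖iteratedFDeriv ℝ m u y‖ₑ) x := by
  have : Nonempty (Fin n) := ⟨⟨0, by omega⟩⟩
  set B := Metric.ball (0 : EuclideanSpace ℝ (Fin n)) 1 with hB
  have hB0 : volume B ≠ 0 := (Metric.measure_ball_pos _ _ one_pos).ne'
  have hBt : volume B ≠ ⊤ := measure_ball_lt_top.ne
  refine ⟨(volume B)⁻¹.toNNReal, fun u hu hc x => ?_⟩
  rw [ENNReal.coe_toNNReal (ENNReal.inv_ne_top.2 hB0), mul_comm, ← div_eq_mul_inv,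
    ENNReal.le_div_iff_mul_le (Or.inl hB0) (Or.inl hBt)]
  have hcont : Continuous (iteratedFDeriv ℝ m u) :=
    hu.continuous_iteratedFDeriv (by exact_mod_cast le_top)
  set g : EuclideanSpace ℝ (Fin n) → ℝ≥0∞ := fun y => ‖iteratedFDeriv ℝ m u y‖ₑ with hg
  have hgc : Continuous g := hcont.enorm
  obtain ⟨k, rfl⟩ : ∃ k, m = k + 1 := ⟨m - 1, by omega⟩
  calc ‖u x‖ₑ * volume B = ∫⁻ w in B, ‖u x‖ₑ := by rw [setLIntegral_const]
    _ ≤ ∫⁻ w in B, ∫⁻ r in Ioi (0 : ℝ), ENNReal.ofReal (r ^ k) * g (x + r • w) := by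
        refine lintegral_mono_ae ?_
        have h0 : ∀ᵐ w ∂(volume.restrict B), w ≠ (0 : EuclideanSpace ℝ (Fin n)) :=
          ae_restrict_of_ae (by simp [ae_iff])
        filter_upwards [ae_restrict_mem Metric.isOpen_ball.measurableSet, h0] with w hw hw0
        refine enorm_le_lintegral_ray hu hc x w hw0 ?_ k
        exact (mem_ball_zero_iff.1 hw).le
    _ = ∫⁻ r in Ioi (0 : ℝ), ∫⁻ w in B, ENNReal.ofReal (r ^ k) * g (x + r • w) := by
        refine lintegral_lintegral_swap (Measurable.aemeasurable ?_)
        have h1 : Measurable fun p : EuclideanSpace ℝ (Fin n) × ℝ => ENNReal.ofReal (p.2 ^ k) := by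
          fun_prop
        have h2 : Continuous fun p : EuclideanSpace ℝ (Fin n) × ℝ => g (x + p.2 • p.1) := by
          fun_prop
        exact h1.mul h2.measurable
    _ = ballPotential (k + 1) g x := by
        refine setLIntegral_congr_fun measurableSet_Ioi fun r hr => ?_
        have hr' : (0 : ℝ) < r := hr
        have h3 : Measurable fun w : EuclideanSpace ℝ (Fin n) => g (x + r • w) :=
          (by fun_prop : Continuous fun w : EuclideanSpace ℝ (Fin n) => g (x + r • w)).measurable
        rw [lintegral_const_mul _ h3, lintegral_unitBall_comp_add_smul hgc.measurable x hr',
          ← mul_assoc, ← ENNReal.ofReal_mul (by positivity), ← Real.rpow_natCast,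
          ← Real.rpow_add hr']
        congr 3
        push_cast
        ring

theorem lintegral_comp_mul_left {c : ℝ} (hc : 0 < c) {F : ℝ → ℝ≥0∞} (hF : Measurable F) :
    ∫⁻ q, F (c * q) = ENNReal.ofReal c⁻¹ * ∫⁻ q, F q := by
  have h : ∫⁻ q, F (c * q) = ∫⁻ z, F z ∂(Measure.map (fun q => c * q) volume) :=
    (lintegral_map hF (measurable_const_mul c)).symm
  rw [h, Real.map_volume_mul_left hc.ne', lintegral_smul_measure, abs_of_pos (inv_pos.2 hc),
    smul_eq_mul]

theorem setLIntegral_Ioi_comp_mul_left {c r : ℝ} (hc : 0 < c) {F : ℝ → ℝ≥0∞} (hF : Measurable F) :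
    ∫⁻ q in Ioi r, F (c * q) = ENNReal.ofReal c⁻¹ * ∫⁻ q in Ioi (c * r), F q := by
  rw [← lintegral_indicator measurableSet_Ioi, ← lintegral_indicator measurableSet_Ioi,
    ← lintegral_comp_mul_left hc (hF.indicator measurableSet_Ioi)]
  congr 1 with q
  simp [indicator, hc]

/-- A set of reals which is upward closed is almost an open half-line starting at its infimum. -/
theorem IsUpperSet.ae_eq_Ioi_sInf {S : Set ℝ} (hS : IsUpperSet S) (hne : S.Nonempty)
    (hbdd : BddBelow S) : Ioi (sInf S) ⊆ S ∧ S ⊆ Ici (sInf S) := by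
  refine ⟨fun r hr => ?_, fun r hr => csInf_le hbdd hr⟩
  obtain ⟨s, hs, hsr⟩ := (csInf_lt_iff hbdd hne).1 hr
  exact hS hsr.le hs

theorem setLIntegral_upperSet_le {S : Set ℝ} (hS : IsUpperSet S) (hbdd : BddBelow S)
    {b : ℝ → ℝ≥0∞} {c : ℝ≥0∞} (h : ∀ r ∈ S, ∫⁻ q in Ioi r, b q ≤ c) : ∫⁻ q in S, b q ≤ c := by
  rcases S.eq_empty_or_nonempty with rfl | hne
  · simp
  obtain ⟨h1, h2⟩ := hS.ae_eq_Ioi_sInf hne hbdd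
  obtain ⟨r, hr, hra, hrt⟩ := exists_seq_strictAnti_tendsto (sInf S)
  calc ∫⁻ q in S, b q ≤ ∫⁻ q in Ici (sInf S), b q := lintegral_mono_set h2
    _ = ∫⁻ q in Ioi (sInf S), b q := setLIntegral_congr Ioi_ae_eq_Ici.symm
    _ ≤ ∫⁻ q in ⋃ k, Ioi (r k), b q := by
        refine lintegral_mono_set fun q hq => ?_
        obtain ⟨k, hk⟩ := (hrt.eventually (gt_mem_nhds hq)).exists
        exact mem_iUnion.2 ⟨k, hk⟩
    _ = ⨆ k, ∫⁻ q in Ioi (r k), b q := by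
        refine setLIntegral_iUnion_of_directed b (Monotone.directed_le fun i j hij => ?_)
        exact Ioi_subset_Ioi (hr.antitone hij)
    _ ≤ c := iSup_le fun k => h _ (h1 (hra k))

/-- If `W` is non-increasing, the part of `∫ W^β r^(-mβ-1) dr` where `W r ≤ C r^m` is bounded by a
constant which does not depend on `W`. -/
theorem lintegral_capped_le {W : ℝ → ℝ≥0∞} (hW : Antitone W) {m β C : ℝ} (hm : 0 < m) (hβ : 0 < β)
    (hC : 0 < C) :
    ∫⁻ r in Ioi (0 : ℝ), {r : ℝ | W r ≤ ENNReal.ofReal (C * r ^ m)}.indicator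
      (fun r => W r ^ β * ENNReal.ofReal (r ^ (-(m * β) - 1))) r ≤
      ENNReal.ofReal (C ^ β / (m * β)) := by
  set S : Set ℝ := Ioi 0 ∩ {r : ℝ | W r ≤ ENNReal.ofReal (C * r ^ m)} with hSdef
  have hS : IsUpperSet S := by
    rintro a b hab ⟨ha, ha'⟩
    have ha0 : (0 : ℝ) < a := ha
    refine ⟨ha0.trans_le hab, ((hW hab).trans ha').trans (ENNReal.ofReal_le_ofReal ?_)⟩
    gcongr
  have hbdd : BddBelow S := ⟨0, fun r hr => le_of_lt hr.1⟩
  rcases S.eq_empty_or_nonempty with hemp | hne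
  · refine le_of_eq_of_le ?_ zero_le
    rw [← lintegral_zero (μ := volume.restrict (Ioi (0:ℝ)))]
    refine setLIntegral_congr_fun measurableSet_Ioi fun r hr => ?_
    have : r ∉ {r : ℝ | W r ≤ ENNReal.ofReal (C * r ^ m)} := fun h => by
      have : r ∈ S := ⟨hr, h⟩
      rw [hemp] at this
      exact this
    simp only [indicator_of_notMem this]
  obtain ⟨h1, h2⟩ := hS.ae_eq_Ioi_sInf hne hbdd
  set a := sInf S with ha
  have ha0 : 0 ≤ a := le_csInf hne fun r hr => le_of_lt hr.1
  have hWa : ∀ r ∈ Ioi a, W r ≤ ENNReal.ofReal (C * a ^ m) := by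
    intro r hr
    have hcont : Continuous fun q : ℝ => ENNReal.ofReal (C * q ^ m) :=
      ENNReal.continuous_ofReal.comp
        (continuous_const.mul (Real.continuous_rpow_const hm.le))
    refine ge_of_tendsto (hcont.continuousWithinAt (s := Ioi a) (x := a)) ?_
    filter_upwards [Ioo_mem_nhdsGT (show a < r from hr)] with q hq
    exact (hW hq.2.le).trans (h1 hq.1).2
  calc _ ≤ ∫⁻ r in Ioi a, (W r ^ β * ENNReal.ofReal (r ^ (-(m * β) - 1))) := by
        rw [← lintegral_indicator measurableSet_Ioi, ← lintegral_indicator measurableSet_Ioi]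
        refine lintegral_mono_ae ?_
        have hne' : ∀ᵐ r : ℝ, r ≠ a := by simp [ae_iff]
        filter_upwards [hne'] with r hr
        by_cases hrS : r ∈ S
        · have : r ∈ Ioi a := lt_of_le_of_ne (h2 hrS) (Ne.symm hr)
          rw [indicator_of_mem (show r ∈ Ioi (0:ℝ) from hrS.1), indicator_of_mem hrS.2,
            indicator_of_mem this]
        · refine le_of_eq_of_le ?_ zero_le
          by_cases hr0 : r ∈ Ioi (0 : ℝ)
          · rw [indicator_of_mem hr0, indicator_of_notMem (fun h => hrS ⟨hr0, h⟩)]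
          · rw [indicator_of_notMem hr0]
    _ ≤ ∫⁻ r in Ioi a, ENNReal.ofReal (C * a ^ m) ^ β * ENNReal.ofReal (r ^ (-(m * β) - 1)) := by
        refine setLIntegral_mono' measurableSet_Ioi fun r hr => ?_
        gcongr
        exact hWa r hr
    _ = ENNReal.ofReal (C * a ^ m) ^ β *
          ∫⁻ r in Ioi a, ENNReal.ofReal (r ^ (-(m * β) - 1)) :=
        lintegral_const_mul _ (by fun_prop)
    _ ≤ _ := by
        rcases ha0.eq_or_lt with h | h
        · rw [← h, Real.zero_rpow hm.ne', mul_zero, ENNReal.ofReal_zero, ENNReal.zero_rpow_of_pos hβ,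
            zero_mul]
          exact zero_le
        · rw [lintegral_Ioi_rpow (mul_pos hm hβ) h, ENNReal.ofReal_rpow_of_pos (by positivity),
            ← ENNReal.ofReal_mul (by positivity)]
          refine ENNReal.ofReal_le_ofReal (le_of_eq ?_)
          rw [Real.mul_rpow hC.le (by positivity), ← Real.rpow_mul h.le, mul_assoc, ← mul_div_assoc,
            ← Real.rpow_add h]
          simp [div_eq_mul_inv]

section TailPotential

variable {n : ℕ}

/-- The part over radii larger than `r` of the potential of the indicator function of `E`. -/
noncomputable def tailPotential (m : ℕ) (E : Set (EuclideanSpace ℝ (Fin n)))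
    (x : EuclideanSpace ℝ (Fin n)) (r : ℝ) : ℝ≥0∞ :=
  ∫⁻ q in Ioi r, ENNReal.ofReal (q ^ ((m : ℝ) - n - 1)) * volume (E ∩ Metric.ball x q)

theorem tailPotential_antitone (m : ℕ) (E : Set (EuclideanSpace ℝ (Fin n)))
    (x : EuclideanSpace ℝ (Fin n)) : Antitone (tailPotential m E x) :=
  fun _ _ h => lintegral_mono_set (Ioi_subset_Ioi h)

theorem measurable_volume_inter_ball {ι : Type*} [MeasurableSpace ι]
    {E : ι → Set (EuclideanSpace ℝ (Fin n))}
    (hE : MeasurableSet {p : ι × EuclideanSpace ℝ (Fin n) | p.2 ∈ E p.1})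
    {x : ι → EuclideanSpace ℝ (Fin n)} (hx : Measurable x) {q : ι → ℝ} (hq : Measurable q) :
    Measurable fun i => volume (E i ∩ Metric.ball (x i) (q i)) := by
  have hs : MeasurableSet {p : ι × EuclideanSpace ℝ (Fin n) |
      p.2 ∈ E p.1 ∩ Metric.ball (x p.1) (q p.1)} := by
    refine hE.inter ?_
    exact measurableSet_lt (measurable_snd.dist (hx.comp measurable_fst)) (hq.comp measurable_fst)
  exact measurable_measure_prodMk_left hs

theorem measurable_tailPotential (m : ℕ) {ι : Type*} [MeasurableSpace ι]
    {E : ι → Set (EuclideanSpace ℝ (Fin n))}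
    (hE : MeasurableSet {p : ι × EuclideanSpace ℝ (Fin n) | p.2 ∈ E p.1})
    {x : ι → EuclideanSpace ℝ (Fin n)} (hx : Measurable x) {q : ι → ℝ} (hq : Measurable q) :
    Measurable fun i => tailPotential m (E i) (x i) (q i) := by
  have h1 : (fun i => tailPotential m (E i) (x i) (q i)) = fun i => ∫⁻ s,
      {p : ι × ℝ | q p.1 < p.2}.indicator (fun p : ι × ℝ =>
        ENNReal.ofReal (p.2 ^ ((m : ℝ) - n - 1)) * volume (E p.1 ∩ Metric.ball (x p.1) p.2))
        (i, s) := by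
    funext i
    rw [tailPotential, ← lintegral_indicator measurableSet_Ioi]
    rfl
  rw [h1]
  refine Measurable.lintegral_prod_right' (Measurable.indicator ?_ ?_)
  · refine Measurable.mul (by fun_prop) ?_
    refine measurable_volume_inter_ball (E := fun p : ι × ℝ => E p.1) ?_ (hx.comp measurable_fst)
      measurable_snd
    exact (measurable_fst.fst.prodMk measurable_snd) hE
  · exact measurableSet_lt (hq.comp measurable_fst) measurable_snd

theorem setLIntegral_Ioc_ball_le {m : ℕ} (hm : 1 ≤ m) (hn : 2 ≤ n)
    (E : Set (EuclideanSpace ℝ (Fin n))) (x : EuclideanSpace ℝ (Fin n)) {R : ℝ} (hR : 0 ≤ R) :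
    ∫⁻ q in Ioc 0 R, ENNReal.ofReal (q ^ ((m : ℝ) - n - 1)) * volume (E ∩ Metric.ball x q) ≤
      ENNReal.ofReal ((volume (Metric.ball (0 : EuclideanSpace ℝ (Fin n)) 1)).toReal / m
        * R ^ (m : ℝ)) := by
  have : Nonempty (Fin n) := ⟨⟨0, by omega⟩⟩
  set ω := (volume (Metric.ball (0 : EuclideanSpace ℝ (Fin n)) 1)).toReal with hω
  have hω' : volume (Metric.ball (0 : EuclideanSpace ℝ (Fin n)) 1) = ENNReal.ofReal ω :=
    (ENNReal.ofReal_toReal measure_ball_lt_top.ne).symm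
  have hm0 : (0 : ℝ) < m := by exact_mod_cast hm
  calc _ ≤ ∫⁻ q in Ioc 0 R, ENNReal.ofReal (q ^ ((m : ℝ) - 1)) * ENNReal.ofReal ω := by
        refine setLIntegral_mono' measurableSet_Ioc fun q hq => ?_
        have hq0 : 0 < q := hq.1
        refine (mul_le_mul_right (measure_mono inter_subset_right) _).trans (le_of_eq ?_)
        rw [Measure.addHaar_ball _ _ hq0.le, hω', ← mul_assoc, ← ENNReal.ofReal_mul (by positivity),
          finrank_euclideanSpace_fin, ← Real.rpow_natCast, ← Real.rpow_add hq0]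
        congr 3
        ring
    _ = _ := by
        rw [lintegral_mul_const _ (by fun_prop), ← restrict_Ioo_eq_restrict_Ioc,
          lintegral_Ioo_rpow hm0 le_rfl hR, Real.zero_rpow hm0.ne', sub_zero,
          ← ENNReal.ofReal_mul (by positivity)]
        congr 1
        ring

theorem tailPotential_zero_le {m : ℕ} (hm : 1 ≤ m) (hmn : m < n) (hn : 2 ≤ n) :
    ∃ C : ℝ≥0, ∀ (E : Set (EuclideanSpace ℝ (Fin n))) (x : EuclideanSpace ℝ (Fin n)),
      volume E ≠ ⊤ → tailPotential m E x 0 ≤ C * volume E ^ ((m : ℝ) / n) := by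
  set ω := (volume (Metric.ball (0 : EuclideanSpace ℝ (Fin n)) 1)).toReal with hω
  have hm0 : (0 : ℝ) < m := by exact_mod_cast hm
  have hn0 : (0 : ℝ) < n := by exact_mod_cast (by omega : 0 < n)
  have hs : (0 : ℝ) < (n : ℝ) - m := sub_pos.2 (by exact_mod_cast hmn)
  refine ⟨(ω / m + 1 / ((n : ℝ) - m)).toNNReal, fun E x hE => ?_⟩
  rcases eq_or_ne (volume E) 0 with h0 | h0
  · have : tailPotential m E x 0 = 0 := by
      rw [tailPotential, ← lintegral_zero (μ := volume.restrict (Ioi (0:ℝ)))]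
      congr 1 with q
      rw [measure_mono_null inter_subset_left h0, mul_zero]
    rw [this]
    exact zero_le
  set v := (volume E).toReal with hv
  have hv0 : 0 < v := ENNReal.toReal_pos h0 hE
  have hvE : volume E = ENNReal.ofReal v := (ENNReal.ofReal_toReal hE).symm
  set R := v ^ (1 / (n : ℝ)) with hRdef
  have hR : 0 < R := Real.rpow_pos_of_pos hv0 _
  have hω0 : 0 ≤ ω := ENNReal.toReal_nonneg
  have hRm : R ^ (m : ℝ) = v ^ ((m : ℝ) / n) := by
    rw [hRdef, ← Real.rpow_mul hv0.le]
    congr 1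
    ring
  have hRs : R ^ (-((n : ℝ) - m)) * v = R ^ (m : ℝ) := by
    have hRn : v = R ^ (n : ℝ) := by
      rw [hRdef, ← Real.rpow_mul hv0.le, one_div, inv_mul_cancel₀ hn0.ne', Real.rpow_one]
    calc R ^ (-((n : ℝ) - m)) * v = R ^ (-((n : ℝ) - m)) * R ^ (n : ℝ) := by rw [← hRn]
      _ = R ^ (m : ℝ) := by
        rw [← Real.rpow_add hR]
        congr 1
        ring
  rw [tailPotential, ← Ioc_union_Ioi_eq_Ioi hR.le,
    lintegral_union measurableSet_Ioi (Ioc_disjoint_Ioi le_rfl)]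
  calc _ ≤ ENNReal.ofReal (ω / m * R ^ (m : ℝ)) +
        ENNReal.ofReal (R ^ (-((n : ℝ) - m)) / ((n : ℝ) - m)) * ENNReal.ofReal v := by
        refine add_le_add (setLIntegral_Ioc_ball_le hm hn E x hR.le) ?_
        rw [← lintegral_Ioi_rpow hs hR, ← lintegral_mul_const _ (by fun_prop)]
        refine lintegral_mono fun q => ?_
        rw [← hvE]
        refine mul_le_mul' (le_of_eq ?_) (measure_mono inter_subset_left)
        congr 2
        ring
    _ = _ := by
        rw [← ENNReal.ofReal_mul (by positivity), ← ENNReal.ofReal_add (by positivity) (by positivity),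
          hvE, ENNReal.ofReal_rpow_of_pos hv0, ← hRm, ← ENNReal.ofReal_coe_nnreal,
          ← ENNReal.ofReal_mul (by positivity), Real.coe_toNNReal _ (by positivity)]
        congr 1
        rw [div_mul_eq_mul_div (R ^ (-((n : ℝ) - m))), hRs]
        ring

theorem tailPotential_le_of_dist_le {m : ℕ} {E : Set (EuclideanSpace ℝ (Fin n))}
    (hE : MeasurableSet E) {x y : EuclideanSpace ℝ (Fin n)} {r : ℝ} (hr : 0 < r)
    (hxy : dist x y ≤ r) :
    tailPotential m E x r ≤ ENNReal.ofReal (2 ^ ((n : ℝ) - m)) * tailPotential m E y r := by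
  set F : ℝ → ℝ≥0∞ := fun q =>
    ENNReal.ofReal (q ^ ((m : ℝ) - n - 1)) * volume (E ∩ Metric.ball y q) with hF
  have hFm : Measurable F := by
    refine Measurable.mul (by fun_prop) ?_
    exact measurable_volume_inter_ball (E := fun _ => E) (measurable_snd hE) measurable_const
      measurable_id
  calc tailPotential m E x r ≤ ∫⁻ q in Ioi r, ENNReal.ofReal (2 ^ ((n : ℝ) - m + 1)) * F (2 * q) := by
        refine setLIntegral_mono' measurableSet_Ioi fun q hq => ?_
        have hq' : r < q := hq
        have hq0 : 0 < q := hr.trans hq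
        rw [hF, ← mul_assoc, ← ENNReal.ofReal_mul (by positivity)]
        refine mul_le_mul' (ENNReal.ofReal_le_ofReal (le_of_eq ?_)) (measure_mono ?_)
        · rw [Real.mul_rpow (by norm_num) hq0.le, ← mul_assoc, ← Real.rpow_add (by norm_num)]
          ring_nf
          simp
        · refine inter_subset_inter_right _ (Metric.ball_subset_ball' ?_)
          linarith
    _ = ENNReal.ofReal (2 ^ ((n : ℝ) - m)) * ∫⁻ q in Ioi (2 * r), F q := by
        rw [lintegral_const_mul _ (show Measurable fun q => F (2 * q) by fun_prop),
          setLIntegral_Ioi_comp_mul_left two_pos hFm, ← mul_assoc,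
          ← ENNReal.ofReal_mul (by positivity), Real.rpow_add (by norm_num), Real.rpow_one,
          mul_assoc, mul_inv_cancel₀ (by norm_num), mul_one]
    _ ≤ _ := by
        gcongr
        exact lintegral_mono_set (Ioi_subset_Ioi (by linarith))

end TailPotential

/-- The power `(∫ b)^α` is controlled by the integral of `b W^(α-1)`, where `W` is the tail of `b`,
over the radii where the tail satisfies a growth condition. -/
theorem lintegral_Ioi_rpow_le_capped {b : ℝ → ℝ≥0∞} {c m α : ℝ} (hc : 0 < c)
    (hm : 0 < m) (hα : 1 < α) (hfin : ∫⁻ q in Ioi 0, b q ≠ ⊤)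
    (hb : ∀ R : ℝ, 0 ≤ R → ∫⁻ q in Ioc 0 R, b q ≤ ENNReal.ofReal (c * R ^ m)) :
    (∫⁻ q in Ioi 0, b q) ^ α ≤ ENNReal.ofReal (4 ^ α) * ∫⁻ r in Ioi (0 : ℝ),
      {r : ℝ | ∫⁻ q in Ioi r, b q ≤ ENNReal.ofReal (2 * c * r ^ m)}.indicator
        (fun r => (∫⁻ q in Ioi r, b q) ^ (α - 1) * b r) r := by
  set W : ℝ → ℝ≥0∞ := fun r => ∫⁻ q in Ioi r, b q with hW
  have hWanti : Antitone W := fun _ _ h => lintegral_mono_set (Ioi_subset_Ioi h)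
  change W 0 ^ α ≤ _
  rcases eq_or_ne (W 0) 0 with h0 | h0
  · rw [h0, ENNReal.zero_rpow_of_pos (by linarith)]
    exact zero_le
  set V := (W 0).toReal with hV
  have hV0 : 0 < V := ENNReal.toReal_pos h0 hfin
  have hVW : W 0 = ENNReal.ofReal V := (ENNReal.ofReal_toReal hfin).symm
  set r₁ := (V / (2 * c)) ^ (1 / m) with hr₁def
  have hr₁ : 0 < r₁ := Real.rpow_pos_of_pos (by positivity) _
  have hr₁m : r₁ ^ m = V / (2 * c) := by
    rw [hr₁def, ← Real.rpow_mul (by positivity), one_div, inv_mul_cancel₀ hm.ne', Real.rpow_one]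
  have hsplit : W 0 ≤ ENNReal.ofReal (V / 2) + W r₁ := by
    calc W 0 = ∫⁻ q in Ioc 0 r₁ ∪ Ioi r₁, b q := by rw [Ioc_union_Ioi_eq_Ioi hr₁.le]
      _ ≤ (∫⁻ q in Ioc 0 r₁, b q) + W r₁ := lintegral_union_le _ _ _
      _ ≤ _ := by
        gcongr
        refine (hb r₁ hr₁.le).trans (ENNReal.ofReal_le_ofReal (le_of_eq ?_))
        rw [hr₁m]
        field_simp
  have hW1 : ENNReal.ofReal (V / 2) ≤ W r₁ := by
    have hhalf : ENNReal.ofReal V = ENNReal.ofReal (V / 2) + ENNReal.ofReal (V / 2) := by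
      rw [← ENNReal.ofReal_add (by positivity) (by positivity), add_halves]
    rw [hVW, hhalf] at hsplit
    exact (ENNReal.add_le_add_iff_left ENNReal.ofReal_ne_top).1 hsplit
  set S : Set ℝ := Ioi r₁ ∩ {r | W r < ENNReal.ofReal (V / 4)} with hS
  set T : Set ℝ := Ioi r₁ ∩ {r | ENNReal.ofReal (V / 4) ≤ W r} with hT
  have hSup : IsUpperSet S := fun a b hab ha => ⟨lt_of_lt_of_le ha.1 hab, (hWanti hab).trans_lt ha.2⟩
  have hSle : ∫⁻ q in S, b q ≤ ENNReal.ofReal (V / 4) :=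
    setLIntegral_upperSet_le hSup ⟨r₁, fun r hr => le_of_lt hr.1⟩ fun r hr => le_of_lt hr.2
  have hTmeas : MeasurableSet T :=
    measurableSet_Ioi.inter (measurableSet_le measurable_const hWanti.measurable)
  have hTle : ENNReal.ofReal (V / 4) ≤ ∫⁻ q in T, b q := by
    have h1 : W r₁ ≤ ENNReal.ofReal (V / 4) + ∫⁻ q in T, b q := by
      calc W r₁ ≤ ∫⁻ q in S ∪ T, b q := by
            refine lintegral_mono_set fun q hq => ?_
            rcases lt_or_ge (W q) (ENNReal.ofReal (V / 4)) with h | h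
            · exact Or.inl ⟨hq, h⟩
            · exact Or.inr ⟨hq, h⟩
        _ ≤ _ := (lintegral_union_le _ _ _).trans (by gcongr)
    have h2 := hW1.trans h1
    rw [show V / 2 = V / 4 + V / 4 by ring, ENNReal.ofReal_add (by positivity) (by positivity)] at h2
    exact (ENNReal.add_le_add_iff_left ENNReal.ofReal_ne_top).1 h2
  have h4 : W 0 ^ α = ENNReal.ofReal (4 ^ α) *
      (ENNReal.ofReal (V / 4) ^ (α - 1) * ENNReal.ofReal (V / 4)) := by
    rw [hVW, ENNReal.ofReal_rpow_of_pos hV0, ENNReal.ofReal_rpow_of_pos (by positivity),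
      ← ENNReal.ofReal_mul (by positivity), ← ENNReal.ofReal_mul (by positivity)]
    congr 1
    rw [← Real.rpow_add_one (by positivity), sub_add_cancel, ← Real.mul_rpow (by norm_num)
      (by positivity)]
    congr 1
    ring
  rw [h4]
  gcongr
  calc ENNReal.ofReal (V / 4) ^ (α - 1) * ENNReal.ofReal (V / 4)
      ≤ ENNReal.ofReal (V / 4) ^ (α - 1) * ∫⁻ q in T, b q := by gcongr
    _ = ∫⁻ q in T, ENNReal.ofReal (V / 4) ^ (α - 1) * b q :=
        (lintegral_const_mul' _ _ (ENNReal.rpow_ne_top_of_nonneg (by linarith)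
          ENNReal.ofReal_ne_top)).symm
    _ ≤ ∫⁻ r in T, {r : ℝ | W r ≤ ENNReal.ofReal (2 * c * r ^ m)}.indicator
        (fun r => W r ^ (α - 1) * b r) r := by
        refine setLIntegral_mono' hTmeas fun r hr => ?_
        have hrr : r₁ < r := hr.1
        have : r ∈ {r : ℝ | W r ≤ ENNReal.ofReal (2 * c * r ^ m)} := by
          refine (hWanti (hr₁.trans hrr).le).trans ?_
          rw [hVW]
          refine ENNReal.ofReal_le_ofReal ?_
          calc V = 2 * c * r₁ ^ m := by rw [hr₁m]; field_simp
            _ ≤ 2 * c * r ^ m := by gcongr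
        rw [indicator_of_mem this]
        gcongr
        exact hr.2
    _ ≤ _ := lintegral_mono_set fun r hr => hr₁.trans hr.1

section StrongType

variable {n : ℕ}

/-- Strong-type estimate, on indicator functions, for potentials of order `m` with respect to a
measure whose balls have mass `O(r^d)`, where `d < n - m`, at the exponent `(n - d) / m`. -/
theorem lintegral_tailPotential_rpow_le {m : ℕ} (hm : 1 ≤ m) (hmn : m < n) (hn : 2 ≤ n) {d : ℝ}
    (hd : d < (n : ℝ) - m) (μ : Measure (EuclideanSpace ℝ (Fin n)))
    [IsFiniteMeasure μ] {A : ℝ} (hA : 0 ≤ A)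
    (hμ : ∀ x r, 0 < r → μ (Metric.ball x r) ≤ ENNReal.ofReal (A * r ^ d)) :
    ∃ C : ℝ≥0, ∀ E : Set (EuclideanSpace ℝ (Fin n)), MeasurableSet E → volume E ≠ ⊤ →
      ∫⁻ x, tailPotential m E x 0 ^ (((n : ℝ) - d) / m) ∂μ ≤ C * volume E := by
  have : Nonempty (Fin n) := ⟨⟨0, by omega⟩⟩
  obtain ⟨CB, hCB⟩ := tailPotential_zero_le (n := n) hm hmn hn
  set α := ((n : ℝ) - d) / m with hα
  set ω := (volume (Metric.ball (0 : EuclideanSpace ℝ (Fin n)) 1)).toReal with hω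
  have hm0 : (0 : ℝ) < m := by exact_mod_cast hm
  have hn0 : (0 : ℝ) < n := by exact_mod_cast (by omega : 0 < n)
  have hα1 : 1 < α := by rw [hα, lt_div_iff₀ hm0]; linarith
  have hω0 : 0 < ω := ENNReal.toReal_pos (Metric.measure_ball_pos _ _ one_pos).ne'
    measure_ball_lt_top.ne
  set c := ω / m with hc
  have hc0 : 0 < c := by positivity
  set κ : ℝ := 2 ^ ((n : ℝ) - m) with hκ
  have hκ0 : 0 < κ := by positivity
  refine ⟨(4 ^ α * (κ ^ (α - 1) * (A * ((κ * (2 * c)) ^ (α - 1) / (m * (α - 1)))))).toNNReal,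
    fun E hE hEt => ?_⟩
  set W := fun y r => tailPotential m E y r with hW
  have hWm : Measurable fun p : ℝ × EuclideanSpace ℝ (Fin n) => W p.2 p.1 :=
    measurable_tailPotential m (E := fun _ => E) (measurable_snd hE) measurable_snd measurable_fst
  set Φ : ℝ × EuclideanSpace ℝ (Fin n) → ℝ≥0∞ :=
    {p : ℝ × EuclideanSpace ℝ (Fin n) |
      W p.2 p.1 ≤ ENNReal.ofReal (κ * (2 * c) * p.1 ^ (m : ℝ))}.indicator
      (fun p => W p.2 p.1 ^ (α - 1) * ENNReal.ofReal (p.1 ^ ((m : ℝ) - n - 1))) with hΦ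
  have hΦm : Measurable Φ :=
    ((hWm.pow_const _).mul (by fun_prop)).indicator (measurableSet_le hWm (by fun_prop))
  have hα10 : 0 ≤ α - 1 := by linarith
  -- pointwise estimate
  have hpt : ∀ x, W x 0 ^ α ≤ ENNReal.ofReal (4 ^ α) * (ENNReal.ofReal (κ ^ (α - 1)) *
      ∫⁻ r in Ioi (0 : ℝ), ∫⁻ y in E, (Metric.ball y r).indicator (fun _ => Φ (r, y)) x) := by
    intro x
    have hfin : W x 0 ≠ ⊤ := ne_top_of_le_ne_top (ENNReal.mul_ne_top ENNReal.coe_ne_top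
      (ENNReal.rpow_ne_top_of_nonneg (by positivity) hEt)) (hCB E x hEt)
    refine (lintegral_Ioi_rpow_le_capped hc0 hm0 hα1 hfin
      fun R hR => setLIntegral_Ioc_ball_le hm hn E x hR).trans ?_
    gcongr
    rw [← lintegral_const_mul' _ _ ENNReal.ofReal_ne_top]
    refine setLIntegral_mono' measurableSet_Ioi fun r hr => ?_
    have hr0 : (0 : ℝ) < r := hr
    rw [← lintegral_const_mul' _ _ ENNReal.ofReal_ne_top]
    by_cases hcap : W x r ≤ ENNReal.ofReal (2 * c * r ^ (m : ℝ))
    · refine (le_of_eq (indicator_of_mem (by exact hcap) _)).trans ?_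
      change W x r ^ (α - 1) * (ENNReal.ofReal (r ^ ((m : ℝ) - n - 1)) *
        volume (E ∩ Metric.ball x r)) ≤ _
      calc _ = ∫⁻ y in E, (Metric.ball x r).indicator (fun _ => W x r ^ (α - 1) *
              ENNReal.ofReal (r ^ ((m : ℝ) - n - 1))) y := by
            rw [lintegral_indicator Metric.isOpen_ball.measurableSet, setLIntegral_const,
              Measure.restrict_apply Metric.isOpen_ball.measurableSet, inter_comm E, mul_assoc]
        _ ≤ _ := by
            refine lintegral_mono fun y => ?_
            by_cases hy : y ∈ Metric.ball x r
            · have hy1 : dist x y ≤ r := by rw [dist_comm]; exact (Metric.mem_ball.1 hy).le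
              have hy2 : dist y x ≤ r := (Metric.mem_ball.1 hy).le
              rw [indicator_of_mem hy, indicator_of_mem (Metric.mem_ball_comm.1 hy)]
              have hmem : (r, y) ∈ {p : ℝ × EuclideanSpace ℝ (Fin n) |
                  W p.2 p.1 ≤ ENNReal.ofReal (κ * (2 * c) * p.1 ^ (m : ℝ))} := by
                refine (tailPotential_le_of_dist_le hE hr0 hy2).trans ?_
                refine (mul_le_mul_right hcap _).trans (le_of_eq ?_)
                rw [← ENNReal.ofReal_mul hκ0.le]
                ring_nf
              rw [hΦ, indicator_of_mem hmem, ← mul_assoc]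
              refine mul_le_mul' ?_ le_rfl
              rw [← ENNReal.ofReal_rpow_of_pos hκ0, ← ENNReal.mul_rpow_of_nonneg _ _ hα10]
              exact ENNReal.rpow_le_rpow (tailPotential_le_of_dist_le hE hr0 hy1) hα10
            · rw [indicator_of_notMem hy]
              exact zero_le
    · refine (le_of_eq (indicator_of_notMem (by exact hcap) _)).trans ?_
      exact zero_le
  have hmeas3 : Measurable fun p : (EuclideanSpace ℝ (Fin n) × ℝ) × EuclideanSpace ℝ (Fin n) =>
      (Metric.ball p.2 p.1.2).indicator (fun _ => Φ (p.1.2, p.2)) p.1.1 := by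
    have h1 : MeasurableSet {p : (EuclideanSpace ℝ (Fin n) × ℝ) × EuclideanSpace ℝ (Fin n) |
        dist p.1.1 p.2 < p.1.2} := measurableSet_lt (by fun_prop) (by fun_prop)
    have h2 : Measurable fun p : (EuclideanSpace ℝ (Fin n) × ℝ) × EuclideanSpace ℝ (Fin n) =>
        Φ (p.1.2, p.2) := hΦm.comp (by fun_prop)
    exact h2.indicator h1
  have hswap : ∫⁻ x, (∫⁻ r in Ioi (0 : ℝ), ∫⁻ y in E,
      (Metric.ball y r).indicator (fun _ => Φ (r, y)) x) ∂μ =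
      ∫⁻ y in E, ∫⁻ r in Ioi (0 : ℝ), Φ (r, y) * μ (Metric.ball y r) := by
    rw [lintegral_lintegral_swap]
    · rw [lintegral_lintegral_swap (μ := volume.restrict E)]
      · refine lintegral_congr fun r => ?_
        rw [lintegral_lintegral_swap]
        · refine lintegral_congr fun y => ?_
          rw [lintegral_indicator Metric.isOpen_ball.measurableSet, setLIntegral_const]
        · exact (hmeas3.comp (f := fun p : EuclideanSpace ℝ (Fin n) × EuclideanSpace ℝ (Fin n) =>
            ((p.1, r), p.2)) (by fun_prop)).aemeasurable
      · have h1 : MeasurableSet {q : (EuclideanSpace ℝ (Fin n) × ℝ) × EuclideanSpace ℝ (Fin n) |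
            dist q.2 q.1.1 < q.1.2} := measurableSet_lt (by fun_prop) (by fun_prop)
        exact ((hΦm.comp measurable_swap).mul (measurable_measure_prodMk_left h1)).aemeasurable
    · exact (hmeas3.lintegral_prod_right' (ν := volume.restrict E)).aemeasurable
  have hinner : ∀ y, ∫⁻ r in Ioi (0 : ℝ), Φ (r, y) * μ (Metric.ball y r) ≤
      ENNReal.ofReal (A * ((κ * (2 * c)) ^ (α - 1) / (m * (α - 1)))) := by
    intro y
    rw [ENNReal.ofReal_mul hA]
    refine le_trans ?_ (mul_le_mul_right (lintegral_capped_le (W := W y)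
      (tailPotential_antitone m E y) hm0 (β := α - 1) (by linarith) (C := κ * (2 * c))
      (by positivity)) _)
    rw [← lintegral_const_mul' _ _ ENNReal.ofReal_ne_top]
    refine setLIntegral_mono' measurableSet_Ioi fun r hr => ?_
    have hr0 : (0 : ℝ) < r := hr
    by_cases hcap : W y r ≤ ENNReal.ofReal (κ * (2 * c) * r ^ (m : ℝ))
    · have hmem : (r, y) ∈ {p : ℝ × EuclideanSpace ℝ (Fin n) |
          W p.2 p.1 ≤ ENNReal.ofReal (κ * (2 * c) * p.1 ^ (m : ℝ))} := hcap
      rw [hΦ, indicator_of_mem hmem]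
      refine le_trans ?_ (mul_le_mul_right (le_of_eq (indicator_of_mem (by exact hcap) _).symm) _)
      refine (mul_le_mul_right (hμ y r hr0) _).trans (le_of_eq ?_)
      dsimp only
      rw [mul_left_comm, mul_assoc, ← ENNReal.ofReal_mul (by positivity),
        ← ENNReal.ofReal_mul (by positivity)]
      congr 2
      rw [mul_left_comm, ← Real.rpow_add hr0]
      congr 2
      rw [hα]
      field_simp
      ring
    · have hmem : (r, y) ∉ {p : ℝ × EuclideanSpace ℝ (Fin n) |
          W p.2 p.1 ≤ ENNReal.ofReal (κ * (2 * c) * p.1 ^ (m : ℝ))} := hcap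
      rw [hΦ, indicator_of_notMem hmem, zero_mul]
      exact zero_le
  calc _ ≤ ∫⁻ x, ENNReal.ofReal (4 ^ α) * (ENNReal.ofReal (κ ^ (α - 1)) *
      ∫⁻ r in Ioi (0 : ℝ), ∫⁻ y in E, (Metric.ball y r).indicator (fun _ => Φ (r, y)) x) ∂μ :=
        lintegral_mono hpt
    _ = ENNReal.ofReal (4 ^ α) * (ENNReal.ofReal (κ ^ (α - 1)) *
          ∫⁻ y in E, ∫⁻ r in Ioi (0 : ℝ), Φ (r, y) * μ (Metric.ball y r)) := by
        rw [lintegral_const_mul' _ _ ENNReal.ofReal_ne_top,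
          lintegral_const_mul' _ _ ENNReal.ofReal_ne_top, hswap]
    _ ≤ ENNReal.ofReal (4 ^ α) * (ENNReal.ofReal (κ ^ (α - 1)) *
          (ENNReal.ofReal (A * ((κ * (2 * c)) ^ (α - 1) / (m * (α - 1)))) * volume E)) := by
        gcongr
        rw [← setLIntegral_const]
        exact lintegral_mono fun y => hinner y
    _ = _ := by
        have : 0 ≤ (κ * (2 * c)) ^ (α - 1) / (m * (α - 1)) := by positivity
        rw [← ENNReal.ofReal_coe_nnreal, Real.coe_toNNReal _ (by positivity),
          ENNReal.ofReal_mul (by positivity : (0 : ℝ) ≤ 4 ^ α),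
          ENNReal.ofReal_mul (by positivity : (0 : ℝ) ≤ κ ^ (α - 1)), mul_assoc, mul_assoc]

end StrongType

theorem volume_Ioi_inter_setOf_ofReal_lt (c : ℝ≥0∞) :
    volume (Ioi 0 ∩ {ρ : ℝ | ENNReal.ofReal ρ < c}) = c := by
  rcases eq_or_ne c ⊤ with rfl | hc
  · simp
  · have : Ioi 0 ∩ {ρ : ℝ | ENNReal.ofReal ρ < c} = Ioo 0 c.toReal := by
      ext ρ
      constructor
      · rintro ⟨h1, h2⟩
        exact ⟨h1, (ENNReal.ofReal_lt_iff_lt_toReal (le_of_lt h1) hc).1 h2⟩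
      · rintro ⟨h1, h2⟩
        exact ⟨h1, (ENNReal.ofReal_lt_iff_lt_toReal (le_of_lt h1) hc).2 h2⟩
    rw [this, Real.volume_Ioo, sub_zero, ENNReal.ofReal_toReal hc]

/-- Layer cake formula for functions with values in `ℝ≥0∞`. -/
theorem lintegral_eq_lintegral_Ioi_meas_ofReal_lt {X : Type*} [MeasurableSpace X] (ν : Measure X)
    [SFinite ν] {f : X → ℝ≥0∞} (hf : Measurable f) :
    ∫⁻ x, f x ∂ν = ∫⁻ ρ in Ioi (0 : ℝ), ν {x | ENNReal.ofReal ρ < f x} := by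
  have hs : MeasurableSet {p : X × ℝ | ENNReal.ofReal p.2 < f p.1} :=
    measurableSet_lt (by fun_prop) (by fun_prop)
  calc ∫⁻ x, f x ∂ν = ∫⁻ x, (∫⁻ ρ in Ioi (0 : ℝ),
        {p : X × ℝ | ENNReal.ofReal p.2 < f p.1}.indicator 1 (x, ρ)) ∂ν := by
        refine lintegral_congr fun x => ?_
        have hm : MeasurableSet {ρ : ℝ | ENNReal.ofReal ρ < f x} := measurable_prodMk_left hs
        have h1 : (fun ρ : ℝ => {p : X × ℝ | ENNReal.ofReal p.2 < f p.1}.indicator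
          (1 : X × ℝ → ℝ≥0∞) (x, ρ)) = {ρ : ℝ | ENNReal.ofReal ρ < f x}.indicator 1 := rfl
        rw [h1, lintegral_indicator_one hm, Measure.restrict_apply hm, inter_comm,
          volume_Ioi_inter_setOf_ofReal_lt]
    _ = ∫⁻ ρ in Ioi (0 : ℝ), ∫⁻ x, {p : X × ℝ | ENNReal.ofReal p.2 < f p.1}.indicator 1 (x, ρ)
          ∂ν := lintegral_lintegral_swap (measurable_one.indicator hs).aemeasurable
    _ = _ := by
        refine lintegral_congr fun ρ => ?_
        have hm : MeasurableSet {x | ENNReal.ofReal ρ < f x} := measurable_prodMk_right hs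
        have h1 : (fun x : X => {p : X × ℝ | ENNReal.ofReal p.2 < f p.1}.indicator
          (1 : X × ℝ → ℝ≥0∞) (x, ρ)) = {x | ENNReal.ofReal ρ < f x}.indicator 1 := rfl
        rw [h1, lintegral_indicator_one hm]

section LayerCake

variable {n : ℕ}

theorem measurableSet_superlevel {X : Type*} [MeasurableSpace X] {g : X → ℝ≥0∞}
    (hg : Measurable g) : MeasurableSet {p : ℝ × X | p.2 ∈ {y | ENNReal.ofReal p.1 < g y}} :=
  measurableSet_lt (f := fun p : ℝ × X => ENNReal.ofReal p.1) (g := fun p => g p.2) (by fun_prop)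
    (by fun_prop)

/-- The potential of a function is the superposition of the potentials of its superlevel sets. -/
theorem ballPotential_eq_lintegral_tailPotential (m : ℕ)
    {g : EuclideanSpace ℝ (Fin n) → ℝ≥0∞} (hg : Measurable g) (x : EuclideanSpace ℝ (Fin n)) :
    ballPotential m g x =
      ∫⁻ ρ in Ioi (0 : ℝ), tailPotential m {y | ENNReal.ofReal ρ < g y} x 0 := by
  have hs := measurableSet_superlevel hg
  have hmeas : Measurable fun p : ℝ × ℝ => volume ({y | ENNReal.ofReal p.2 < g y} ∩
      Metric.ball x p.1) := by
    refine measurable_volume_inter_ball (ι := ℝ × ℝ)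
      (E := fun p => {y | ENNReal.ofReal p.2 < g y}) ?_ measurable_const measurable_fst
    exact measurableSet_lt (f := fun p : (ℝ × ℝ) × EuclideanSpace ℝ (Fin n) =>
      ENNReal.ofReal p.1.2) (g := fun p => g p.2) (by fun_prop) (by fun_prop)
  unfold ballPotential tailPotential
  rw [lintegral_lintegral_swap]
  · refine lintegral_congr fun r => ?_
    rw [lintegral_const_mul' _ _ ENNReal.ofReal_ne_top,
      lintegral_eq_lintegral_Ioi_meas_ofReal_lt _ hg]
    congr 1
    refine lintegral_congr fun ρ => ?_
    exact Measure.restrict_apply (measurable_prodMk_left hs)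
  · have : Measurable fun p : ℝ × ℝ => ENNReal.ofReal (p.2 ^ ((m : ℝ) - n - 1)) *
        volume ({y | ENNReal.ofReal p.1 < g y} ∩ Metric.ball x p.2) :=
      Measurable.mul (by fun_prop) (hmeas.comp measurable_swap)
    exact this.aemeasurable

/-- Minkowski's integral inequality. -/
theorem lintegral_lintegral_rpow_le {X Y : Type*} [MeasurableSpace X] [MeasurableSpace Y]
    {μ : Measure X} {ν : Measure Y} [SFinite μ] [SFinite ν] {T : Y → X → ℝ≥0∞}
    (hT : Measurable (Function.uncurry T)) {p : ℝ} (hp : 1 < p)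
    (hfin : ∫⁻ x, (∫⁻ y, T y x ∂ν) ^ p ∂μ ≠ ⊤) :
    ∫⁻ x, (∫⁻ y, T y x ∂ν) ^ p ∂μ ≤ (∫⁻ y, (∫⁻ x, T y x ^ p ∂μ) ^ (1 / p) ∂ν) ^ p := by
  set v : X → ℝ≥0∞ := fun x => ∫⁻ y, T y x ∂ν with hv
  set A := ∫⁻ x, v x ^ p ∂μ with hA
  set B := ∫⁻ y, (∫⁻ x, T y x ^ p ∂μ) ^ (1 / p) ∂ν with hB
  change A ≤ B ^ p
  rcases eq_or_ne A 0 with h0 | h0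
  · rw [h0]; exact zero_le
  have hpq := Real.HolderConjugate.conjExponent hp
  set q := p.conjExponent
  have hTs : Measurable (Function.uncurry fun x y => T y x) := hT.comp measurable_swap
  have hvm : Measurable v := hTs.lintegral_prod_right'
  have hle : A ≤ B * A ^ (1 / q) := by
    calc A = ∫⁻ x, (∫⁻ y, T y x * v x ^ (p - 1) ∂ν) ∂μ := by
          refine lintegral_congr fun x => ?_
          rw [lintegral_mul_const _ (show Measurable fun y => T y x from hTs.comp measurable_prodMk_left)]
          conv_lhs => rw [show p = 1 + (p - 1) by ring]
          rw [ENNReal.rpow_add_of_nonneg _ _ zero_le_one (by linarith), ENNReal.rpow_one]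
      _ = ∫⁻ y, (∫⁻ x, T y x * v x ^ (p - 1) ∂μ) ∂ν := by
          refine lintegral_lintegral_swap (Measurable.aemeasurable ?_)
          exact hTs.mul ((hvm.comp measurable_fst).pow_const _)
      _ ≤ ∫⁻ y, (∫⁻ x, T y x ^ p ∂μ) ^ (1 / p) * A ^ (1 / q) ∂ν := by
          refine lintegral_mono fun y => ?_
          refine (ENNReal.lintegral_mul_le_Lp_mul_Lq μ hpq
            (hT.comp measurable_prodMk_left).aemeasurable
            (hvm.pow_const _).aemeasurable).trans (le_of_eq ?_)
          congr 2
          refine lintegral_congr fun x => ?_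
          rw [← ENNReal.rpow_mul, hpq.sub_one_mul_conj]
      _ = B * A ^ (1 / q) := lintegral_mul_const' _ _
          (ENNReal.rpow_ne_top_of_nonneg (by have := hpq.symm.pos; positivity) hfin)
  have hA' : A = A ^ (1 / p) * A ^ (1 / q) := by
    rw [← ENNReal.rpow_add _ _ h0 hfin, one_div, one_div, hpq.inv_add_inv_eq_one, ENNReal.rpow_one]
  have hpos : A ^ (1 / q) ≠ 0 := (ENNReal.rpow_pos (pos_iff_ne_zero.2 h0) hfin).ne'
  have hnt : A ^ (1 / q) ≠ ⊤ :=
    ENNReal.rpow_ne_top_of_nonneg (by have := hpq.symm.pos; positivity) hfin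
  have h1 : A ^ (1 / p) ≤ B := by
    rw [hA'] at hle
    conv_rhs at hle => rw [← hA']
    exact (ENNReal.mul_le_mul_iff_left hpos hnt).1 hle
  calc A = (A ^ (1 / p)) ^ p := by
        rw [← ENNReal.rpow_mul, one_div, inv_mul_cancel₀ (by linarith), ENNReal.rpow_one]
    _ ≤ B ^ p := ENNReal.rpow_le_rpow h1 (by linarith)

/-- Splitting of the potential of `g` at height `l`: the contribution of the low levels is bounded
pointwise and the contribution of the high levels is bounded in `L^((n - d) / m)(μ)`. -/
theorem exists_ballPotential_le_add {m : ℕ} (hm : 1 ≤ m) (hmn : m < n) (hn : 2 ≤ n) {d : ℝ}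
    (hd : d < (n : ℝ) - m) (μ : Measure (EuclideanSpace ℝ (Fin n)))
    [IsFiniteMeasure μ] {A : ℝ} (hA : 0 ≤ A)
    (hμ : ∀ x r, 0 < r → μ (Metric.ball x r) ≤ ENNReal.ofReal (A * r ^ d)) :
    ∃ C : ℝ≥0, ∀ g : EuclideanSpace ℝ (Fin n) → ℝ≥0∞, Measurable g →
      volume {y | 0 < g y} ≠ ⊤ → (∃ M : ℝ, ∀ y, g y ≤ ENNReal.ofReal M) →
      ∀ l : ℝ, 0 ≤ l → ∃ v : EuclideanSpace ℝ (Fin n) → ℝ≥0∞, Measurable v ∧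
        (∀ x, ballPotential m g x ≤ v x + C * ∫⁻ ρ in Ioc 0 l,
          volume {y | ENNReal.ofReal ρ < g y} ^ ((m : ℝ) / n)) ∧
        ∫⁻ x, v x ^ (((n : ℝ) - d) / m) ∂μ ≤ (C * ∫⁻ ρ in Ioi l,
          volume {y | ENNReal.ofReal ρ < g y} ^ ((m : ℝ) / (n - d))) ^ (((n : ℝ) - d) / m) := by
  obtain ⟨C₁, hC₁⟩ := tailPotential_zero_le (n := n) hm hmn hn
  obtain ⟨C₂, hC₂⟩ := lintegral_tailPotential_rpow_le hm hmn hn hd μ hA hμ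
  have hm0 : (0 : ℝ) < m := by exact_mod_cast hm
  have hn0 : (0 : ℝ) < n := by exact_mod_cast (by omega : 0 < n)
  have hα1 : 1 < ((n : ℝ) - d) / m := by rw [lt_div_iff₀ hm0]; linarith
  have ha : (m : ℝ) / (n - d) = 1 / (((n : ℝ) - d) / m) := by rw [one_div_div]
  set α := ((n : ℝ) - d) / m with hα
  have hmn' : 0 ≤ (m : ℝ) / n := by positivity
  refine ⟨C₁ + C₂ ^ (1 / α), fun g hg hgv hgM l hl => ?_⟩
  obtain ⟨M, hM⟩ := hgM
  have hs := measurableSet_superlevel hg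
  set L : ℝ → Set (EuclideanSpace ℝ (Fin n)) := fun ρ => {y | ENNReal.ofReal ρ < g y} with hL
  have hLm : ∀ ρ, MeasurableSet (L ρ) := fun ρ => measurable_prodMk_left hs
  have hLle : ∀ ρ, volume (L ρ) ≤ volume {y | 0 < g y} := fun ρ =>
    measure_mono fun y (hy : ENNReal.ofReal ρ < g y) => show 0 < g y from lt_of_le_of_lt zero_le hy
  have hLt : ∀ ρ, volume (L ρ) ≠ ⊤ := fun ρ => ne_top_of_le_ne_top hgv (hLle ρ)
  have hT : Measurable (Function.uncurry fun ρ x => tailPotential m (L ρ) x 0) := by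
    refine measurable_tailPotential m (ι := ℝ × EuclideanSpace ℝ (Fin n))
      (E := fun p => L p.1) ?_ measurable_snd measurable_const
    exact measurableSet_lt (f := fun p : (ℝ × EuclideanSpace ℝ (Fin n)) ×
      EuclideanSpace ℝ (Fin n) => ENNReal.ofReal p.1.1) (g := fun p => g p.2) (by fun_prop)
      (by fun_prop)
  set v : EuclideanSpace ℝ (Fin n) → ℝ≥0∞ :=
    fun x => ∫⁻ ρ in Ioi l, tailPotential m (L ρ) x 0 with hv
  have hvm : Measurable v := (hT.comp measurable_swap).lintegral_prod_right'
  refine ⟨v, hvm, fun x => ?_, ?_⟩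
  · rw [ballPotential_eq_lintegral_tailPotential m hg, ← Ioc_union_Ioi_eq_Ioi hl]
    refine (lintegral_union_le _ _ _).trans ?_
    rw [add_comm]
    gcongr
    rw [← lintegral_const_mul' _ _ ENNReal.coe_ne_top]
    refine lintegral_mono fun ρ => (hC₁ _ x (hLt ρ)).trans ?_
    gcongr
    exact le_self_add
  · have hvle : ∀ x, v x ≤ C₁ * volume {y | 0 < g y} ^ ((m : ℝ) / n) * ENNReal.ofReal (M - l) := by
      intro x
      calc v x ≤ ∫⁻ ρ in Ioi l, (Iic M).indicator
            (fun _ => C₁ * volume {y | 0 < g y} ^ ((m : ℝ) / n)) ρ := by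
            refine lintegral_mono fun ρ => ?_
            by_cases hρ : ρ ≤ M
            · rw [indicator_of_mem (by exact hρ)]
              refine (hC₁ _ x (hLt ρ)).trans ?_
              exact mul_le_mul' le_rfl (ENNReal.rpow_le_rpow (hLle ρ) hmn')
            · have : L ρ = ∅ := by
                refine eq_empty_of_forall_notMem fun y hy => ?_
                exact absurd (hy.trans_le (hM y))
                  (not_lt.2 (ENNReal.ofReal_le_ofReal (not_le.1 hρ).le))
              simp [this, tailPotential]
        _ = _ := by
            rw [lintegral_indicator measurableSet_Iic, setLIntegral_const,
              Measure.restrict_apply measurableSet_Iic, inter_comm, Ioi_inter_Iic, Real.volume_Ioc]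
    have hfin : ∫⁻ x, v x ^ α ∂μ ≠ ⊤ := by
      refine ne_top_of_le_ne_top ?_ (lintegral_mono fun x =>
        ENNReal.rpow_le_rpow (hvle x) (by linarith : 0 ≤ α))
      rw [lintegral_const]
      refine ENNReal.mul_ne_top (ENNReal.rpow_ne_top_of_nonneg (by linarith) ?_)
        (measure_ne_top _ _)
      exact ENNReal.mul_ne_top (ENNReal.mul_ne_top ENNReal.coe_ne_top
        (ENNReal.rpow_ne_top_of_nonneg hmn' hgv)) ENNReal.ofReal_ne_top
    refine (lintegral_lintegral_rpow_le hT hα1 hfin).trans ?_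
    refine ENNReal.rpow_le_rpow ?_ (by linarith)
    rw [← lintegral_const_mul' _ _ ENNReal.coe_ne_top]
    refine lintegral_mono fun ρ => ?_
    have hα0 : 0 ≤ 1 / α := by rw [one_div]; exact inv_nonneg.2 (by linarith)
    refine (ENNReal.rpow_le_rpow (hC₂ _ (hLm ρ) (hLt ρ)) hα0).trans ?_
    rw [ENNReal.mul_rpow_of_nonneg _ _ hα0, ← ENNReal.coe_rpow_of_nonneg _ hα0, ha]
    gcongr
    exact le_add_self

end LayerCake

section Rearrangement

variable {X : Type*} [MeasurableSpace X] {ν : Measure X}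

theorem rearr_antitone (u : X → ℝ) : Antitone (rearr ν u) := fun _ _ h =>
  sInf_le_sInf fun _ hρ => le_trans hρ (ENNReal.ofReal_le_ofReal h)

theorem lt_meas_of_lt_rearr {u : X → ℝ} {s : ℝ} {ρ : ℝ≥0∞} (h : ρ < rearr ν u s) :
    ENNReal.ofReal s < ν {x | ρ < ENNReal.ofReal |u x|} := by
  by_contra! hc
  exact absurd h (not_lt.2 (sInf_le hc))

theorem le_rearr_of_lt_meas {u : X → ℝ} {s : ℝ} {ρ : ℝ≥0∞}
    (h : ENNReal.ofReal s < ν {x | ρ < ENNReal.ofReal |u x|}) : ρ ≤ rearr ν u s := by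
  refine le_sInf fun ρ' hρ' => ?_
  by_contra! hc
  exact absurd (h.trans_le ((measure_mono fun x (hx : ρ < _) => hc.trans hx).trans hρ'))
    (lt_irrefl _)

theorem rearr_le_of_forall_le {u : X → ℝ} {M : ℝ} (h : ∀ x, |u x| ≤ M) (s : ℝ) :
    rearr ν u s ≤ ENNReal.ofReal M := by
  refine sInf_le ?_
  have : {x | ENNReal.ofReal M < ENNReal.ofReal |u x|} = ∅ :=
    eq_empty_of_forall_notMem fun x hx => absurd (show ENNReal.ofReal M < _ from hx)
      (not_lt.2 (ENNReal.ofReal_le_ofReal (h x)))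
  simp [this]

theorem Ioi_inter_setOf_ofReal_mul_lt {P : ℝ} (hP : 0 < P) {c : ℝ≥0∞} (hc : c ≠ ⊤) :
    Ioi 0 ∩ {s : ℝ | ENNReal.ofReal (P * s) < c} = Ioo 0 (c.toReal / P) := by
  ext s
  constructor
  · rintro ⟨h1, h2⟩
    refine ⟨h1, ?_⟩
    rw [lt_div_iff₀ hP, mul_comm]
    exact (ENNReal.ofReal_lt_iff_lt_toReal (mul_nonneg hP.le (le_of_lt h1)) hc).1 h2
  · rintro ⟨h1, h2⟩
    refine ⟨h1, (ENNReal.ofReal_lt_iff_lt_toReal (mul_nonneg hP.le h1.le) hc).2 ?_⟩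
    rwa [lt_div_iff₀ hP, mul_comm] at h2

/-- Truncated integrals of powers of the rearrangement of a function dominated by the sum of a
function `w` and of a constant. -/
theorem lintegral_rearr_rpow_le [IsFiniteMeasure ν] {P : ℝ} (hP : 0 < P) {u : X → ℝ}
    {w : X → ℝ≥0∞} (hw : Measurable w) {B : ℝ≥0∞} (h : ∀ x, ENNReal.ofReal |u x| ≤ w x + B)
    {α : ℝ} (hα : 1 ≤ α) (t : ℝ) :
    ∫⁻ s in Ioo 0 t, rearr ν u (P * s) ^ α ≤
      2 ^ (α - 1) * (ENNReal.ofReal P⁻¹ * ∫⁻ x, w x ^ α ∂ν + ENNReal.ofReal t * B ^ α) := by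
  have hα0 : 0 < α := by linarith
  have hm : Measurable fun s => rearr ν u (P * s) := by
    refine Antitone.measurable fun a b hab => rearr_antitone u ?_
    gcongr
  have hmain : ∫⁻ s in Ioi 0, (rearr ν u (P * s) - B) ^ α ≤
      ENNReal.ofReal P⁻¹ * ∫⁻ x, w x ^ α ∂ν := by
    rw [lintegral_eq_lintegral_Ioi_meas_ofReal_lt _ ((hm.sub_const B).pow_const α),
      lintegral_eq_lintegral_Ioi_meas_ofReal_lt _ (hw.pow_const α),
      ← lintegral_const_mul' _ _ ENNReal.ofReal_ne_top]
    refine lintegral_mono fun ρ => ?_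
    set c := ν {x | ENNReal.ofReal ρ ^ (1 / α) + B < ENNReal.ofReal |u x|} with hc
    have hct : c ≠ ⊤ := measure_ne_top _ _
    have key : ∀ y : ℝ≥0∞, ENNReal.ofReal ρ < y ^ α ↔ ENNReal.ofReal ρ ^ (1 / α) < y := by
      intro y
      rw [one_div]
      exact (ENNReal.rpow_inv_lt_iff hα0).symm
    calc volume.restrict (Ioi 0) {s | ENNReal.ofReal ρ < (rearr ν u (P * s) - B) ^ α}
        ≤ volume.restrict (Ioi 0) {s | ENNReal.ofReal (P * s) < c} := by
          refine measure_mono fun s hs => ?_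
          refine lt_meas_of_lt_rearr ?_
          have := (key _).1 hs
          exact lt_tsub_iff_right.1 this
      _ = volume (Ioo 0 (c.toReal / P)) := by
          rw [Measure.restrict_apply (measurableSet_lt (by fun_prop) (by fun_prop)), inter_comm,
            Ioi_inter_setOf_ofReal_mul_lt hP hct]
      _ = ENNReal.ofReal P⁻¹ * c := by
          rw [Real.volume_Ioo, sub_zero, div_eq_inv_mul, ENNReal.ofReal_mul (by positivity),
            ENNReal.ofReal_toReal hct]
      _ ≤ _ := by
          refine mul_le_mul' le_rfl (measure_mono fun x hx => ?_)
          refine (key _).2 ?_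
          exact lt_of_add_lt_add_right ((show _ < _ from hx).trans_le (h x))
  calc ∫⁻ s in Ioo 0 t, rearr ν u (P * s) ^ α
      ≤ ∫⁻ s in Ioo 0 t, 2 ^ (α - 1) * ((rearr ν u (P * s) - B) ^ α + B ^ α) := by
        refine lintegral_mono fun s => ?_
        refine le_trans ?_ (ENNReal.rpow_add_le_mul_rpow_add_rpow _ _ hα)
        exact ENNReal.rpow_le_rpow le_tsub_add hα0.le
    _ = 2 ^ (α - 1) * ((∫⁻ s in Ioo 0 t, (rearr ν u (P * s) - B) ^ α) +
          ENNReal.ofReal t * B ^ α) := by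
        rw [lintegral_const_mul' _ _ (ENNReal.rpow_ne_top_of_nonneg (by linarith)
          ENNReal.ofNat_ne_top), lintegral_add_right _ measurable_const, setLIntegral_const,
          Real.volume_Ioo, sub_zero, mul_comm (ENNReal.ofReal t)]
    _ ≤ _ := by
        gcongr
        exact (lintegral_mono_set Ioo_subset_Ioi_self).trans hmain

end Rearrangement

theorem volume_Ioi_inter_setOf_ofReal_le {c : ℝ≥0∞} :
    volume (Ioi 0 ∩ {ρ : ℝ | ENNReal.ofReal ρ ≤ c}) ≤ c := by
  rcases eq_or_ne c ⊤ with rfl | hc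
  · simp
  · have : Ioi 0 ∩ {ρ : ℝ | ENNReal.ofReal ρ ≤ c} ⊆ Ioc 0 c.toReal := fun ρ h =>
      ⟨h.1, (ENNReal.ofReal_le_iff_le_toReal hc).1 h.2⟩
    refine (measure_mono this).trans ?_
    rw [Real.volume_Ioc, sub_zero, ENNReal.ofReal_toReal hc]

theorem rpow_eq_lintegral_indicator {V : ℝ} (hV : 0 < V) {p : ℝ} (hp : 0 < p) {c : ℝ≥0∞}
    (hc : c ≠ ⊤) : c ^ p = ENNReal.ofReal (p * V ^ p) * ∫⁻ s in Ioi (0 : ℝ),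
      {s : ℝ | ENNReal.ofReal (V * s) < c}.indicator (fun s => ENNReal.ofReal (s ^ (p - 1))) s := by
  rw [lintegral_indicator (measurableSet_lt (by fun_prop) (by fun_prop)),
    Measure.restrict_restrict (measurableSet_lt (by fun_prop) (by fun_prop)), inter_comm,
    Ioi_inter_setOf_ofReal_mul_lt hV hc, lintegral_Ioo_rpow hp le_rfl (by positivity),
    ← ENNReal.ofReal_mul (by positivity), Real.zero_rpow hp.ne', sub_zero,
    Real.div_rpow ENNReal.toReal_nonneg hV.le]
  have : 0 < V ^ p := by positivity
  rw [show p * V ^ p * (c.toReal ^ p / V ^ p / p) = c.toReal ^ p by field_simp,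
    ← ENNReal.ofReal_rpow_of_nonneg ENNReal.toReal_nonneg hp.le, ENNReal.ofReal_toReal hc]

section Levels

variable {X : Type*} [MeasurableSpace X] {ν : Measure X} [IsFiniteMeasure ν] {G : X → ℝ}
  {V : ℝ}

theorem measurable_meas_superlevel_rpow_kernel (hG : Measurable G) (V p : ℝ) :
    Measurable fun q : ℝ × ℝ =>
      {s : ℝ | ENNReal.ofReal (V * s) < ν {x | ENNReal.ofReal q.1 < ENNReal.ofReal |G x|}}.indicator
        (fun s => ENNReal.ofReal (s ^ (p - 1))) q.2 := by
  have hs : MeasurableSet {r : ℝ × X | ENNReal.ofReal r.1 < ENNReal.ofReal |G r.2|} :=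
    measurableSet_lt (f := fun r : ℝ × X => ENNReal.ofReal r.1)
      (g := fun r => ENNReal.ofReal |G r.2|) (by fun_prop)
      (ENNReal.measurable_ofReal.comp ((hG.comp measurable_snd).abs))
  have h1 : Measurable fun ρ : ℝ => ν {x | ENNReal.ofReal ρ < ENNReal.ofReal |G x|} :=
    measurable_measure_prodMk_left hs
  have h2 : MeasurableSet {q : ℝ × ℝ | ENNReal.ofReal (V * q.2) <
      ν {x | ENNReal.ofReal q.1 < ENNReal.ofReal |G x|}} :=
    measurableSet_lt (by fun_prop) (h1.comp measurable_fst)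
  have h3 : Measurable fun q : ℝ × ℝ => ENNReal.ofReal (q.2 ^ (p - 1)) := by fun_prop
  exact h3.indicator h2

/-- High levels: the integral of a power of the distribution function is controlled by the
rearrangement near the origin. -/
theorem lintegral_Ioi_meas_rpow_le (hG : Measurable G) (hV : 0 < V) {p : ℝ} (hp : 0 < p) {τ l : ℝ}
    (hl : rearr ν G (V * τ) ≤ ENNReal.ofReal l) (hl0 : 0 ≤ l) :
    ∫⁻ ρ in Ioi l, ν {x | ENNReal.ofReal ρ < ENNReal.ofReal |G x|} ^ p ≤
      ENNReal.ofReal (p * V ^ p) * ∫⁻ s in Ioo 0 τ,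
        ENNReal.ofReal (s ^ (p - 1)) * rearr ν G (V * s) := by
  simp_rw [rpow_eq_lintegral_indicator hV hp (measure_ne_top ν _)]
  rw [lintegral_const_mul' _ _ ENNReal.ofReal_ne_top]
  refine mul_le_mul' le_rfl ?_
  rw [lintegral_lintegral_swap (measurable_meas_superlevel_rpow_kernel hG V p).aemeasurable,
    ← lintegral_indicator measurableSet_Ioo, ← lintegral_indicator measurableSet_Ioi]
  refine lintegral_mono fun s => ?_
  by_cases hs0 : 0 < s
  swap
  · rw [indicator_of_notMem (by exact hs0)]
    exact zero_le
  rw [indicator_of_mem (by exact hs0)]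
  by_cases hs : s < τ
  · rw [indicator_of_mem (show s ∈ Ioo 0 τ from ⟨hs0, hs⟩)]
    calc _ ≤ ∫⁻ ρ in Ioi l, {ρ : ℝ | ENNReal.ofReal ρ ≤ rearr ν G (V * s)}.indicator
            (fun _ => ENNReal.ofReal (s ^ (p - 1))) ρ := by
          refine lintegral_mono fun ρ => ?_
          by_cases hρ : ENNReal.ofReal (V * s) < ν {x | ENNReal.ofReal ρ < ENNReal.ofReal |G x|}
          · rw [indicator_of_mem (by exact hρ), indicator_of_mem (by exact le_rearr_of_lt_meas hρ)]
          · rw [indicator_of_notMem (by exact hρ)]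
            exact zero_le
      _ ≤ _ := by
          have hm : MeasurableSet {ρ : ℝ | ENNReal.ofReal ρ ≤ rearr ν G (V * s)} :=
            measurableSet_le (by fun_prop) (by fun_prop)
          rw [lintegral_indicator hm, setLIntegral_const, Measure.restrict_apply hm]
          refine mul_le_mul' le_rfl (le_trans (measure_mono ?_) volume_Ioi_inter_setOf_ofReal_le)
          exact fun ρ hρ => ⟨lt_of_le_of_lt hl0 hρ.2, hρ.1⟩
  · rw [indicator_of_notMem (fun h => hs h.2)]
    refine le_of_eq (setLIntegral_eq_zero measurableSet_Ioi fun ρ hρ => ?_)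
    refine indicator_of_notMem (fun h => ?_) _
    have h1 : ENNReal.ofReal ρ ≤ ENNReal.ofReal l := by
      refine (le_rearr_of_lt_meas h).trans (le_trans ?_ hl)
      exact rearr_antitone G (mul_le_mul_of_nonneg_left (not_lt.1 hs) hV.le)
    exact absurd ((ENNReal.ofReal_le_ofReal_iff hl0).1 h1) (not_le.2 hρ)

/-- Low levels: the integral of a power of the distribution function is controlled by the
rearrangement away from the origin. -/
theorem lintegral_Ioc_meas_rpow_le (hG : Measurable G) (hV : 0 < V)
    (hVν : ν univ ≤ ENNReal.ofReal V) {p : ℝ} (hp : 0 < p) {τ : ℝ} (hτ : 0 < τ) (l : ℝ) :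
    ∫⁻ ρ in Ioc 0 l, ν {x | ENNReal.ofReal ρ < ENNReal.ofReal |G x|} ^ p ≤
      ENNReal.ofReal (p * V ^ p) * (ENNReal.ofReal (τ ^ p / p) * ENNReal.ofReal l +
        ∫⁻ s in Ioo τ 1, ENNReal.ofReal (s ^ (p - 1)) * rearr ν G (V * s)) := by
  simp_rw [rpow_eq_lintegral_indicator hV hp (measure_ne_top ν _)]
  rw [lintegral_const_mul' _ _ ENNReal.ofReal_ne_top]
  refine mul_le_mul' le_rfl ?_
  rw [lintegral_lintegral_swap (measurable_meas_superlevel_rpow_kernel hG V p).aemeasurable]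
  have hsub : Ioi (0 : ℝ) ⊆ (Ioo 0 τ ∪ {τ}) ∪ (Ioo τ 1 ∪ Ici 1 ∩ Ioi 0) := by
    intro s (hs : 0 < s)
    rcases lt_trichotomy s τ with h | h | h
    · exact Or.inl (Or.inl ⟨hs, h⟩)
    · exact Or.inl (Or.inr h)
    · rcases lt_or_ge s 1 with h' | h'
      · exact Or.inr (Or.inl ⟨h, h'⟩)
      · exact Or.inr (Or.inr ⟨h', hs⟩)
  set Φ : ℝ → ℝ≥0∞ := fun s => ∫⁻ ρ in Ioc 0 l, {s : ℝ | ENNReal.ofReal (V * s) <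
    ν {x | ENNReal.ofReal ρ < ENNReal.ofReal |G x|}}.indicator
      (fun s => ENNReal.ofReal (s ^ (p - 1))) s with hΦ
  have h1 : ∫⁻ s in Ioo 0 τ, Φ s ≤ ENNReal.ofReal (τ ^ p / p) * ENNReal.ofReal l := by
    calc _ ≤ ∫⁻ s in Ioo 0 τ, ENNReal.ofReal (s ^ (p - 1)) * ENNReal.ofReal l := by
          refine lintegral_mono fun s => ?_
          calc Φ s ≤ ∫⁻ ρ in Ioc 0 l, ENNReal.ofReal (s ^ (p - 1)) :=
                lintegral_mono fun ρ => indicator_le_self' (fun _ _ => zero_le) s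
            _ = _ := by rw [setLIntegral_const, Real.volume_Ioc, sub_zero]
      _ = _ := by
          rw [lintegral_mul_const' _ _ ENNReal.ofReal_ne_top, lintegral_Ioo_rpow hp le_rfl hτ.le,
            Real.zero_rpow hp.ne', sub_zero]
  have h2 : ∫⁻ s in Ioo τ 1, Φ s ≤
      ∫⁻ s in Ioo τ 1, ENNReal.ofReal (s ^ (p - 1)) * rearr ν G (V * s) := by
    refine lintegral_mono fun s => ?_
    calc Φ s ≤ ∫⁻ ρ in Ioc 0 l, {ρ : ℝ | ENNReal.ofReal ρ ≤ rearr ν G (V * s)}.indicator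
            (fun _ => ENNReal.ofReal (s ^ (p - 1))) ρ := by
          refine lintegral_mono fun ρ => ?_
          by_cases hρ : ENNReal.ofReal (V * s) < ν {x | ENNReal.ofReal ρ < ENNReal.ofReal |G x|}
          · rw [indicator_of_mem (by exact hρ), indicator_of_mem (by exact le_rearr_of_lt_meas hρ)]
          · rw [indicator_of_notMem (by exact hρ)]
            exact zero_le
      _ ≤ _ := by
          have hm : MeasurableSet {ρ : ℝ | ENNReal.ofReal ρ ≤ rearr ν G (V * s)} :=
            measurableSet_le (by fun_prop) (by fun_prop)
          rw [lintegral_indicator hm, setLIntegral_const, Measure.restrict_apply hm]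
          refine mul_le_mul' le_rfl (le_trans (measure_mono ?_) volume_Ioi_inter_setOf_ofReal_le)
          exact fun ρ hρ => ⟨hρ.2.1, hρ.1⟩
  have h3 : ∫⁻ s in Ici 1 ∩ Ioi 0, Φ s = 0 := by
    refine setLIntegral_eq_zero (measurableSet_Ici.inter measurableSet_Ioi) fun s hs => ?_
    have : ∀ ρ : ℝ, {s : ℝ | ENNReal.ofReal (V * s) <
        ν {x | ENNReal.ofReal ρ < ENNReal.ofReal |G x|}}.indicator
          (fun s => ENNReal.ofReal (s ^ (p - 1))) s = 0 := fun ρ => by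
      refine indicator_of_notMem (fun h => ?_) _
      have h4 : ENNReal.ofReal (V * s) < ENNReal.ofReal V :=
        lt_of_lt_of_le h ((measure_mono (subset_univ _)).trans hVν)
      exact absurd h4 (not_lt.2 (ENNReal.ofReal_le_ofReal (le_mul_of_one_le_right hV.le hs.1)))
    simp [hΦ, this]
  calc ∫⁻ s in Ioi 0, Φ s ≤ ∫⁻ s in (Ioo 0 τ ∪ {τ}) ∪ (Ioo τ 1 ∪ Ici 1 ∩ Ioi 0), Φ s :=
        lintegral_mono_set hsub
    _ ≤ (∫⁻ s in Ioo 0 τ ∪ {τ}, Φ s) + ∫⁻ s in Ioo τ 1 ∪ Ici 1 ∩ Ioi 0, Φ s :=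
        lintegral_union_le _ _ _
    _ ≤ ((∫⁻ s in Ioo 0 τ, Φ s) + ∫⁻ s in {τ}, Φ s) +
          ((∫⁻ s in Ioo τ 1, Φ s) + ∫⁻ s in Ici 1 ∩ Ioi 0, Φ s) :=
        add_le_add (lintegral_union_le _ _ _) (lintegral_union_le _ _ _)
    _ ≤ _ := by
        rw [h3, add_zero, setLIntegral_measure_zero {τ} _ (by simp), add_zero]
        exact add_le_add h1 h2

end Levels

section Hardy

variable {n m : ℕ} {d : ℝ}

theorem rpow_mul_rpow_div_rpow_eq (hn : (0 : ℝ) < n) (hd0 : 0 < d) (hd : d < n) {t : ℝ} (ht : 0 < t) :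
    t ^ (-((m : ℝ) / (n - d))) * (t ^ ((n : ℝ) / d)) ^ ((m : ℝ) / (n - d)) =
      (t ^ ((n : ℝ) / d)) ^ ((m : ℝ) / n) := by
  have : (n : ℝ) - d ≠ 0 := by linarith
  rw [← Real.rpow_mul ht.le, ← Real.rpow_mul ht.le, ← Real.rpow_add ht]
  congr 1
  field_simp
  ring

/-- The operator `S2` dominates the pointwise value of a non-increasing function, suitably
weighted. -/
theorem rpow_mul_le_S2 (hn : (0 : ℝ) < n) (hm : (0 : ℝ) < m) (hd0 : 0 < d) (hd : d < n)
    {f : ℝ → ℝ≥0∞} {t : ℝ} (ht : 0 < t) {c : ℝ≥0∞}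
    (hc : ∀ s ∈ Ioo 0 (t ^ ((n : ℝ) / d)), c ≤ f s) :
    ENNReal.ofReal ((t ^ ((n : ℝ) / d)) ^ ((m : ℝ) / n)) * c ≤
      ENNReal.ofReal ((m : ℝ) / (n - d)) * S2 n m d f t := by
  set a := (m : ℝ) / (n - d) with ha
  have ha0 : 0 < a := div_pos hm (by linarith)
  set τ := t ^ ((n : ℝ) / d) with hτ
  have hτ0 : 0 < τ := Real.rpow_pos_of_pos ht _
  have h1 : ENNReal.ofReal (τ ^ a / a) * c ≤
      ∫⁻ s in Ioo 0 τ, ENNReal.ofReal (s ^ (a - 1)) * f s := by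
    calc _ = (∫⁻ s in Ioo 0 τ, ENNReal.ofReal (s ^ (a - 1))) * c := by
          rw [lintegral_Ioo_rpow ha0 le_rfl hτ0.le, Real.zero_rpow ha0.ne', sub_zero]
      _ = ∫⁻ s in Ioo 0 τ, ENNReal.ofReal (s ^ (a - 1)) * c :=
          (lintegral_mul_const _ (by fun_prop)).symm
      _ ≤ _ := setLIntegral_mono' measurableSet_Ioo fun s hs => mul_le_mul' le_rfl (hc s hs)
  calc _ = ENNReal.ofReal a * (ENNReal.ofReal (t ^ (-a)) * (ENNReal.ofReal (τ ^ a / a) * c)) := by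
        rw [← mul_assoc, ← mul_assoc, ← ENNReal.ofReal_mul ha0.le,
          ← ENNReal.ofReal_mul (by positivity), ← rpow_mul_rpow_div_rpow_eq hn hd0 hd ht]
        congr 2
        rw [← ha, ← hτ]
        field_simp
    _ ≤ _ := by
        rw [S2]
        gcongr

/-- The integral in the definition of `S2`. -/
theorem lintegral_eq_rpow_mul_S2 (n m : ℕ) (d : ℝ) (f : ℝ → ℝ≥0∞) {t : ℝ} (ht : 0 < t) :
    ∫⁻ s in Ioo (0 : ℝ) (t ^ ((n : ℝ) / d)),
      ENNReal.ofReal (s ^ ((m : ℝ) / ((n : ℝ) - d) - 1)) * f s =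
      ENNReal.ofReal (t ^ ((m : ℝ) / (n - d))) * S2 n m d f t := by
  rw [S2, ← mul_assoc, ← ENNReal.ofReal_mul (by positivity), ← Real.rpow_add ht, add_neg_cancel,
    Real.rpow_zero, ENNReal.ofReal_one, one_mul]

end Hardy

/-- Integrals of powers of the rearrangement of a smooth function are controlled by Hardy-type
operators applied to the rearrangement of its `m`-th gradient. -/
theorem exists_lintegral_rearr_rpow_le {n m : ℕ} (hm : 1 ≤ m) (hmn : m < n) (hn : 2 ≤ n) {d : ℝ}
    (hd0 : 0 < d) (hd : d < (n : ℝ) - m) {Ω : Set (EuclideanSpace ℝ (Fin n))}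
    (hΩ : volume Ω < ⊤) (hΩ0 : volume Ω ≠ 0) (μ : Measure (EuclideanSpace ℝ (Fin n)))
    [IsFiniteMeasure μ] {A : ℝ} (hA : 0 ≤ A)
    (hμ : ∀ x r, 0 < r → μ (Metric.ball x r) ≤ ENNReal.ofReal (A * r ^ d)) {P : ℝ} (hP : 0 < P) :
    ∃ C : ℝ≥0∞, C ≠ ⊤ ∧ ∀ u : EuclideanSpace ℝ (Fin n) → ℝ,
      ContDiff ℝ (⊤ : ℕ∞) u → HasCompactSupport u → tsupport u ⊆ Ω → ∀ f : ℝ → ℝ≥0∞,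
      (f = fun s => rearr (volume.restrict Ω) (fun x => ‖iteratedFDeriv ℝ m u x‖)
        ((volume Ω).toReal * s)) → ∀ t, 0 < t →
      ∫⁻ s in Ioo 0 t, rearr μ u (P * s) ^ (((n : ℝ) - d) / m) ≤
        C * (ENNReal.ofReal t * (S1 n m d f t ^ (((n : ℝ) - d) / m) +
          S2 n m d f t ^ (((n : ℝ) - d) / m))) := by
  obtain ⟨Cu, hCu⟩ := enorm_le_ballPotential n m hm hn
  obtain ⟨C, hC⟩ := exists_ballPotential_le_add hm hmn hn hd μ hA hμ
  have hm0 : (0 : ℝ) < m := by exact_mod_cast hm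
  have hn0 : (0 : ℝ) < n := by exact_mod_cast (by omega : 0 < n)
  have hdn : d < n := by linarith
  set a := (m : ℝ) / (n - d) with ha
  set b := (m : ℝ) / n with hb
  have ha0 : 0 < a := div_pos hm0 (by linarith)
  have hb0 : 0 < b := div_pos hm0 hn0
  set α := ((n : ℝ) - d) / m with hα
  have hα1 : 1 < α := by rw [hα, lt_div_iff₀ hm0]; linarith
  have hα0 : 0 ≤ α := by linarith
  have haα : a * α = 1 := by
    rw [ha, hα]
    have : (n : ℝ) - d ≠ 0 := by linarith
    field_simp
  have : Fact (volume Ω < ⊤) := ⟨hΩ⟩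
  set ν := (volume : Measure (EuclideanSpace ℝ (Fin n))).restrict Ω with hν
  set V := (volume Ω).toReal with hV
  have hV0 : 0 < V := ENNReal.toReal_pos hΩ0 hΩ.ne
  have hνV : ν univ ≤ ENNReal.ofReal V := by
    rw [hν, Measure.restrict_apply_univ, hV, ENNReal.ofReal_toReal hΩ.ne]
  set K₁ := ENNReal.ofReal (a * V ^ a) with hK₁
  set K₂ := ENNReal.ofReal (b * V ^ b) with hK₂
  set K₃ := ENNReal.ofReal (b⁻¹ * a) with hK₃
  refine ⟨2 ^ (α - 1) * (ENNReal.ofReal P⁻¹ * (Cu * (C * K₁)) ^ α +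
    (Cu * (C * (K₂ * (K₃ + 1)))) ^ α * 2 ^ (α - 1)), ?_, ?_⟩
  · have h2 : (2 : ℝ≥0∞) ^ (α - 1) ≠ ⊤ :=
      ENNReal.rpow_ne_top_of_nonneg (by linarith) ENNReal.ofNat_ne_top
    have h3 : (Cu * (C * K₁) : ℝ≥0∞) ≠ ⊤ :=
      ENNReal.mul_ne_top ENNReal.coe_ne_top (ENNReal.mul_ne_top ENNReal.coe_ne_top
        ENNReal.ofReal_ne_top)
    have h4 : (Cu * (C * (K₂ * (K₃ + 1))) : ℝ≥0∞) ≠ ⊤ :=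
      ENNReal.mul_ne_top ENNReal.coe_ne_top (ENNReal.mul_ne_top ENNReal.coe_ne_top
        (ENNReal.mul_ne_top ENNReal.ofReal_ne_top
          (ENNReal.add_ne_top.2 ⟨ENNReal.ofReal_ne_top, ENNReal.one_ne_top⟩)))
    exact ENNReal.mul_ne_top h2 (ENNReal.add_ne_top.2 ⟨ENNReal.mul_ne_top ENNReal.ofReal_ne_top
      (ENNReal.rpow_ne_top_of_nonneg hα0 h3),
      ENNReal.mul_ne_top (ENNReal.rpow_ne_top_of_nonneg hα0 h4) h2⟩)
  intro u hu huc huΩ f hf t ht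
  set G : EuclideanSpace ℝ (Fin n) → ℝ := fun x => ‖iteratedFDeriv ℝ m u x‖ with hG
  have hGc : Continuous (iteratedFDeriv ℝ m u) :=
    hu.continuous_iteratedFDeriv (by exact_mod_cast le_top)
  have hGm : Measurable G := hGc.norm.measurable
  set g : EuclideanSpace ℝ (Fin n) → ℝ≥0∞ := fun x => ENNReal.ofReal |G x| with hg
  have hgm : Measurable g := ENNReal.measurable_ofReal.comp hGm.abs
  have hge : (fun y => ‖iteratedFDeriv ℝ m u y‖ₑ) = g := by
    funext y
    rw [hg, hG]
    dsimp only
    rw [abs_norm, ofReal_norm]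
  obtain ⟨M, hM⟩ := hGc.bounded_above_of_compact_support (huc.iteratedFDeriv (𝕜 := ℝ) m)
  have hM' : ∀ x, |G x| ≤ M := fun x => by rw [hG]; dsimp only; rw [abs_norm]; exact hM x
  have hsupp : ∀ y, 0 < g y → y ∈ Ω := by
    intro y hy
    refine huΩ (support_iteratedFDeriv_subset (𝕜 := ℝ) m fun h0 => ?_)
    rw [← hge] at hy
    simp [h0] at hy
  have hlev : ∀ ρ : ℝ, volume {y | ENNReal.ofReal ρ < g y} =
      ν {y | ENNReal.ofReal ρ < ENNReal.ofReal |G y|} := by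
    intro ρ
    rw [hν, Measure.restrict_apply (measurableSet_lt measurable_const hgm)]
    congr 1
    exact (inter_eq_left.2 fun y (hy : _ < _) => hsupp y (lt_of_le_of_lt zero_le hy)).symm
  have hg0 : volume {y | 0 < g y} ≠ ⊤ := ne_top_of_le_ne_top hΩ.ne (measure_mono hsupp)
  set τ := t ^ ((n : ℝ) / d) with hτ
  have hτ0 : 0 < τ := Real.rpow_pos_of_pos ht _
  set l := (f τ).toReal with hl
  have hfτ : f τ ≠ ⊤ := ne_top_of_le_ne_top ENNReal.ofReal_ne_top
    (by rw [hf]; exact rearr_le_of_forall_le hM' _)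
  have hll : f τ = ENNReal.ofReal l := (ENNReal.ofReal_toReal hfτ).symm
  have hl0 : 0 ≤ l := ENNReal.toReal_nonneg
  have hlf : rearr ν G (V * τ) = ENNReal.ofReal l := by rw [← hll, hf]
  obtain ⟨v, hvm, hv1, hv2⟩ := hC g hgm hg0 ⟨M, fun y => ENNReal.ofReal_le_ofReal (hM' y)⟩ l hl0
  simp_rw [hlev] at hv1 hv2
  have hhigh := lintegral_Ioi_meas_rpow_le hGm hV0 ha0 hlf.le hl0
  have hlow := lintegral_Ioc_meas_rpow_le hGm hV0 hνV hb0 hτ0 l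
  set H := ∫⁻ ρ in Ioi l, ν {x | ENNReal.ofReal ρ < ENNReal.ofReal |G x|} ^ a with hH
  set L := ∫⁻ ρ in Ioc 0 l, ν {x | ENNReal.ofReal ρ < ENNReal.ofReal |G x|} ^ b with hL
  have hH' : H ≤ K₁ * (ENNReal.ofReal (t ^ a) * S2 n m d f t) := by
    rw [← lintegral_eq_rpow_mul_S2 n m d f ht, hf]
    exact hhigh
  have hL' : L ≤ K₂ * (K₃ + 1) * (S1 n m d f t + S2 n m d f t) := by
    have h1 : ENNReal.ofReal (τ ^ b / b) * ENNReal.ofReal l ≤ K₃ * S2 n m d f t := by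
      have := rpow_mul_le_S2 (n := n) (m := m) hn0 hm0 hd0 hdn (f := f) ht (c := f τ)
        fun s hs => by
          rw [hf]
          exact rearr_antitone G (mul_le_mul_of_nonneg_left hs.2.le hV0.le)
      rw [hK₃, ENNReal.ofReal_mul (by positivity), mul_assoc, div_eq_inv_mul,
        ENNReal.ofReal_mul (by positivity), mul_assoc, ← hll]
      exact mul_le_mul' le_rfl this
    calc L ≤ K₂ * (ENNReal.ofReal (τ ^ b / b) * ENNReal.ofReal l + S1 n m d f t) := by
          rw [S1, hf]
          exact hlow
      _ ≤ K₂ * (K₃ * S2 n m d f t + S1 n m d f t) := by gcongr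
      _ ≤ K₂ * ((K₃ + 1) * S2 n m d f t + (K₃ + 1) * S1 n m d f t) := by
          gcongr
          · exact le_self_add
          · exact le_mul_of_one_le_left zero_le le_add_self
      _ = _ := by ring
  have hu_le : ∀ x, ENNReal.ofReal |u x| ≤ Cu * v x + Cu * (C * L) := by
    intro x
    rw [← mul_add]
    have := hCu u hu huc x
    rw [hge] at this
    rw [← Real.norm_eq_abs, ofReal_norm]
    exact this.trans (mul_le_mul' le_rfl (hv1 x))
  refine (lintegral_rearr_rpow_le hP (hvm.const_mul _) hu_le hα1.le t).trans ?_
  rw [mul_assoc (2 ^ (α - 1))]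
  refine mul_le_mul' le_rfl ?_
  have hta : ENNReal.ofReal (t ^ a) ^ α = ENNReal.ofReal t := by
    rw [ENNReal.ofReal_rpow_of_nonneg (by positivity) hα0, ← Real.rpow_mul ht.le, haα,
      Real.rpow_one]
  have e1 : ∫⁻ x, (Cu * v x) ^ α ∂μ ≤
      (Cu * (C * K₁)) ^ α * (ENNReal.ofReal t * S2 n m d f t ^ α) := by
    calc ∫⁻ x, (Cu * v x) ^ α ∂μ = (Cu : ℝ≥0∞) ^ α * ∫⁻ x, v x ^ α ∂μ := by
          rw [← lintegral_const_mul' _ _ (ENNReal.rpow_ne_top_of_nonneg hα0 ENNReal.coe_ne_top)]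
          simp_rw [ENNReal.mul_rpow_of_nonneg _ _ hα0]
      _ ≤ (Cu : ℝ≥0∞) ^ α * (C * (K₁ * (ENNReal.ofReal (t ^ a) * S2 n m d f t))) ^ α := by
          refine mul_le_mul' le_rfl (hv2.trans (ENNReal.rpow_le_rpow ?_ hα0))
          exact mul_le_mul' le_rfl hH'
      _ = _ := by
          simp_rw [ENNReal.mul_rpow_of_nonneg _ _ hα0, hta]
          ring
  have e2 : (Cu * (C * L)) ^ α ≤ (Cu * (C * (K₂ * (K₃ + 1)))) ^ α *
      (2 ^ (α - 1) * (S1 n m d f t ^ α + S2 n m d f t ^ α)) := by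
    calc (Cu * (C * L)) ^ α
        ≤ (Cu * (C * (K₂ * (K₃ + 1) * (S1 n m d f t + S2 n m d f t)))) ^ α := by gcongr
      _ = (Cu * (C * (K₂ * (K₃ + 1)))) ^ α * (S1 n m d f t + S2 n m d f t) ^ α := by
          rw [← ENNReal.mul_rpow_of_nonneg _ _ hα0]
          ring_nf
      _ ≤ _ := by
          refine mul_le_mul' le_rfl ?_
          exact ENNReal.rpow_add_le_mul_rpow_add_rpow _ _ hα1.le
  calc _ ≤ ENNReal.ofReal P⁻¹ * ((Cu * (C * K₁)) ^ α * (ENNReal.ofReal t *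
            (S1 n m d f t ^ α + S2 n m d f t ^ α))) +
          ENNReal.ofReal t * ((Cu * (C * (K₂ * (K₃ + 1)))) ^ α *
            (2 ^ (α - 1) * (S1 n m d f t ^ α + S2 n m d f t ^ α))) := by
        refine add_le_add (mul_le_mul' le_rfl (e1.trans ?_)) (mul_le_mul' le_rfl e2)
        exact mul_le_mul' le_rfl (mul_le_mul' le_rfl le_add_self)
    _ = _ := by ring

section Antitone

variable {f : ℝ → ℝ≥0∞} {p x y : ℝ}

theorem lintegral_Ioo_rpow_mul_le (hf : Antitone f) (hp : 0 < p) (hx : 0 ≤ x) (hxy : x ≤ y) :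
    ∫⁻ s in Ioo x y, ENNReal.ofReal (s ^ (p - 1)) * f s ≤
      ENNReal.ofReal ((y ^ p - x ^ p) / p) * f x := by
  rw [← lintegral_Ioo_rpow hp hx hxy, ← lintegral_mul_const _ (by fun_prop)]
  exact setLIntegral_mono' measurableSet_Ioo fun s hs => mul_le_mul' le_rfl (hf hs.1.le)

theorem le_lintegral_Ioo_rpow_mul (hf : Antitone f) (hp : 0 < p) (hx : 0 ≤ x) (hxy : x ≤ y) :
    ENNReal.ofReal ((y ^ p - x ^ p) / p) * f y ≤
      ∫⁻ s in Ioo x y, ENNReal.ofReal (s ^ (p - 1)) * f s := by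
  rw [← lintegral_Ioo_rpow hp hx hxy, ← lintegral_mul_const _ (by fun_prop)]
  exact setLIntegral_mono' measurableSet_Ioo fun s hs => mul_le_mul' le_rfl (hf hs.2.le)

end Antitone

theorem lintegral_Ioo_le_add (F : ℝ → ℝ≥0∞) {x y z : ℝ} (hxy : x ≤ y) (hyz : y ≤ z) :
    ∫⁻ s in Ioo x z, F s ≤ (∫⁻ s in Ioo x y, F s) + ∫⁻ s in Ioo y z, F s := by
  simp_rw [restrict_Ioo_eq_restrict_Ioc]
  rw [← Ioc_union_Ioc_eq_Ioc hxy hyz]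
  exact lintegral_union_le _ _ _

theorem ENNReal.rpow_le_rpow_add_mul {α : ℝ} (hα : 1 ≤ α) {x y z : ℝ≥0∞} (hx : x ≠ ⊤)
    (h : x ≤ y + z) : x ^ α ≤ y ^ α + ENNReal.ofReal α * (x ^ (α - 1) * z) := by
  rcases le_or_gt x y with hxy | hxy
  · exact (ENNReal.rpow_le_rpow hxy (by linarith)).trans le_self_add
  have hx0 : x ≠ 0 := (lt_of_le_of_lt zero_le hxy).ne'
  have hy : y ≠ ⊤ := ne_top_of_lt hxy
  refine le_trans ?_ (add_le_add le_rfl (mul_le_mul' le_rfl (mul_le_mul' le_rfl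
    (tsub_le_iff_left.2 h))))
  lift x to ℝ≥0 using hx
  lift y to ℝ≥0 using hy
  have hxp : 0 < x := pos_iff_ne_zero.2 (by exact_mod_cast hx0)
  have hyx : y ≤ x := by exact_mod_cast hxy.le
  rw [← ENNReal.coe_sub, ← ENNReal.coe_rpow_of_nonneg _ (by linarith),
    ← ENNReal.coe_rpow_of_nonneg _ (by linarith), ← ENNReal.coe_rpow_of_nonneg _ (by linarith),
    ENNReal.ofReal, ← ENNReal.coe_mul, ← ENNReal.coe_mul, ← ENNReal.coe_add, ENNReal.coe_le_coe,
    ← NNReal.coe_le_coe]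
  push_cast [NNReal.coe_sub hyx, Real.coe_toNNReal _ (by linarith : 0 ≤ α)]
  have hxr : (0 : ℝ) < x := hxp
  have h1 := one_add_mul_self_le_rpow_one_add (s := (y : ℝ) / x - 1)
    (by have : 0 ≤ (y : ℝ) / x := by positivity
        linarith) hα
  rw [add_sub_cancel, Real.div_rpow y.coe_nonneg hxr.le, le_div_iff₀ (by positivity)] at h1
  have h2 : (x : ℝ) ^ α = x ^ (α - 1) * x := by
    rw [← Real.rpow_add_one hxr.ne', sub_add_cancel]
  have h3 : (1 + α * ((y : ℝ) / x - 1)) * (x : ℝ) ^ α =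
      (x : ℝ) ^ α - α * ((x : ℝ) ^ (α - 1) * (x - y)) := by
    rw [h2]
    field_simp
    ring
  linarith

/-- Lower approximations, on a dyadic grid, of a sum of integrands `S ^ α + S * (t^(-a) G)^(α-1)`. -/
noncomputable def gridValue (S G : ℝ → ℝ≥0∞) (a α : ℝ) (N i : ℕ) : ℝ≥0∞ :=
  S (((i : ℝ) + 1) / N) ^ α + S (((i : ℝ) + 1) / N) *
    (ENNReal.ofReal ((((i : ℝ) + 1) / N) ^ (-a)) * G ((i : ℝ) / N)) ^ (α - 1)

section Grid

variable {S G : ℝ → ℝ≥0∞} {a α : ℝ}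

theorem mul_rpow_le_sum_gridValue_pow (ha : 0 < a) (haα : a * α = 1) (hα : 1 < α)
    (hS : AntitoneOn S (Ioi 0)) (hG : MonotoneOn G (Ici 0)) (hGt : ∀ t, G t ≠ ⊤)
    {D K : ℝ≥0∞} (hD : ∀ t, 0 < t → G (2 * t) ≤ D * G t)
    (hK : ∀ t, 0 < t → 4 * t ≤ 1 → G (4 * t) ≤ G (2 * t) + K * (ENNReal.ofReal (t ^ a) * S t))
    {L : ℕ} {B : ℝ≥0∞} (hB : 2 ^ L * G (4 / (2 ^ L : ℕ)) ^ α ≤ B * S (1 / (2 ^ L : ℕ)) ^ α)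
    (p : ℕ) (hp : p + 2 ≤ L) :
    2 ^ L * G (2 ^ (p + 2) / (2 ^ L : ℕ)) ^ α ≤
      (B + ENNReal.ofReal α * (2 * ((D * (D * D)) ^ (α - 1) * K))) *
        ∑ i ∈ Finset.range (2 ^ p), gridValue S G a α (2 ^ L) i := by
  have hα1 : 0 ≤ α - 1 := by linarith
  induction p with
  | zero =>
    norm_num at hB ⊢
    rw [gridValue]
    norm_num
    exact hB.trans (mul_le_mul' le_self_add le_self_add)
  | succ p ih =>
    specialize ih (by omega)
    set N : ℕ := 2 ^ L with hN
    have hN0 : (0 : ℝ) < N := by rw [hN]; positivity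
    set t : ℝ := 2 ^ (p + 1) / N with ht
    have ht0 : 0 < t := by positivity
    have e1 : (2 : ℝ) ^ (p + 2) / N = 2 * t := by rw [ht]; ring
    have e2 : (2 : ℝ) ^ (p + 1 + 2) / N = 4 * t := by rw [ht]; ring
    have e3 : (2 : ℝ) ^ p / N = t / 2 := by rw [ht]; ring
    have h4t : 4 * t ≤ 1 := by
      rw [← e2, div_le_one hN0, hN]
      push_cast
      exact pow_le_pow_right₀ one_le_two hp
    rw [e2]
    rw [e1] at ih
    have hG4 : G (4 * t) ≤ D * (D * D) * G (t / 2) := by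
      calc G (4 * t) = G (2 * (2 * (2 * (t / 2)))) := by ring_nf
        _ ≤ D * (D * (D * G (t / 2))) := (hD _ (by positivity)).trans (mul_le_mul' le_rfl
            ((hD _ (by positivity)).trans (mul_le_mul' le_rfl (hD _ (by positivity)))))
        _ = _ := by ring
    have hgrid : (2 : ℝ≥0∞) ^ p * (S t * (ENNReal.ofReal (t ^ (-a)) * G (t / 2)) ^ (α - 1)) ≤
        ∑ i ∈ Finset.Ico (2 ^ p) (2 ^ (p + 1)), gridValue S G a α N i := by
      have hcard : (Finset.Ico (2 ^ p) (2 ^ (p + 1))).card = 2 ^ p := by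
        rw [Nat.card_Ico, pow_succ]; omega
      have := Finset.card_nsmul_le_sum (Finset.Ico (2 ^ p) (2 ^ (p + 1)))
        (fun i => gridValue S G a α N i)
        (S t * (ENNReal.ofReal (t ^ (-a)) * G (t / 2)) ^ (α - 1)) ?_
      · rw [hcard, nsmul_eq_mul] at this
        exact_mod_cast this
      · intro i hi
        obtain ⟨hi1, hi2⟩ := Finset.mem_Ico.1 hi
        have hi1' : (2 : ℝ) ^ p ≤ i := by exact_mod_cast hi1
        have hi2' : (i : ℝ) + 1 ≤ 2 ^ (p + 1) := by exact_mod_cast hi2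
        have hb : ((i : ℝ) + 1) / N ≤ t := by rw [ht]; gcongr
        have hb0 : 0 < ((i : ℝ) + 1) / N := by positivity
        have hai : t / 2 ≤ (i : ℝ) / N := by rw [← e3]; gcongr
        refine le_trans ?_ le_add_self
        refine mul_le_mul' (hS hb0 ht0 hb) (ENNReal.rpow_le_rpow (mul_le_mul'
          (ENNReal.ofReal_le_ofReal ?_) (hG (by simp; positivity) (by simp; positivity) hai)) hα1)
        exact Real.rpow_le_rpow_of_nonpos hb0 hb (by linarith)
    have hnum : (2 : ℝ≥0∞) ^ L * ENNReal.ofReal (t ^ a) =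
        2 * (2 ^ p * ENNReal.ofReal (t ^ (-a)) ^ (α - 1)) := by
      have c1 : ∀ k : ℕ, (2 : ℝ≥0∞) ^ k = ENNReal.ofReal (2 ^ k) := fun k => by
        rw [ENNReal.ofReal_pow (by norm_num)]; norm_num
      have c2 : (2 : ℝ≥0∞) = ENNReal.ofReal 2 := by norm_num
      rw [c1, c1, c2, ENNReal.ofReal_rpow_of_nonneg (by positivity) hα1,
        ← ENNReal.ofReal_mul (by positivity), ← ENNReal.ofReal_mul (by positivity),
        ← ENNReal.ofReal_mul (by positivity)]
      congr 1
      rw [← Real.rpow_mul ht0.le, show -a * (α - 1) = a + (-1) by linear_combination -haα,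
        Real.rpow_add ht0, Real.rpow_neg_one]
      have hNe : (N : ℝ) = 2 ^ L := by rw [hN]; push_cast; rfl
      rw [← hNe]
      have : t⁻¹ = N / 2 ^ (p + 1) := by rw [ht, inv_div]
      rw [this, pow_succ]
      field_simp
    have hstep : 2 ^ L * (ENNReal.ofReal α * (G (4 * t) ^ (α - 1) *
        (K * (ENNReal.ofReal (t ^ a) * S t)))) ≤
        ENNReal.ofReal α * (2 * ((D * (D * D)) ^ (α - 1) * K)) *
          ∑ i ∈ Finset.Ico (2 ^ p) (2 ^ (p + 1)), gridValue S G a α N i := by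
      calc _ ≤ 2 ^ L * (ENNReal.ofReal α * ((D * (D * D) * G (t / 2)) ^ (α - 1) *
              (K * (ENNReal.ofReal (t ^ a) * S t)))) := by gcongr
        _ = (2 ^ L * ENNReal.ofReal (t ^ a)) * (ENNReal.ofReal α * ((D * (D * D)) ^ (α - 1) *
              K) * (G (t / 2) ^ (α - 1) * S t)) := by
            rw [ENNReal.mul_rpow_of_nonneg _ _ hα1]; ring
        _ = ENNReal.ofReal α * (2 * ((D * (D * D)) ^ (α - 1) * K)) * (2 ^ p * (S t *
              (ENNReal.ofReal (t ^ (-a)) * G (t / 2)) ^ (α - 1))) := by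
            rw [hnum, ENNReal.mul_rpow_of_nonneg (ENNReal.ofReal (t ^ (-a))) _ hα1]; ring
        _ ≤ _ := by gcongr
    calc 2 ^ L * G (4 * t) ^ α ≤ 2 ^ L * (G (2 * t) ^ α + ENNReal.ofReal α *
            (G (4 * t) ^ (α - 1) * (K * (ENNReal.ofReal (t ^ a) * S t)))) := by
          gcongr
          exact ENNReal.rpow_le_rpow_add_mul hα.le (hGt _) (hK t ht0 h4t)
      _ ≤ (B + ENNReal.ofReal α * (2 * ((D * (D * D)) ^ (α - 1) * K))) *
            (∑ i ∈ Finset.range (2 ^ p), gridValue S G a α N i) +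
          (B + ENNReal.ofReal α * (2 * ((D * (D * D)) ^ (α - 1) * K))) *
          ∑ i ∈ Finset.Ico (2 ^ p) (2 ^ (p + 1)), gridValue S G a α N i := by
          rw [mul_add]
          exact add_le_add ih (hstep.trans (mul_le_mul' le_add_self le_rfl))
      _ = _ := by
          rw [← mul_add, Finset.sum_range_add_sum_Ico _
            (pow_le_pow_right₀ one_le_two (Nat.le_succ p))]

theorem mul_add_mul_rpow_le_sum_gridValue (ha : 0 < a) (haα : a * α = 1) (hα : 1 < α)
    (hS : AntitoneOn S (Ioi 0)) (hG : MonotoneOn G (Ici 0)) (hGt : ∀ t, G t ≠ ⊤)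
    {D K : ℝ≥0∞} (hD : ∀ t, 0 < t → G (2 * t) ≤ D * G t)
    (hK : ∀ t, 0 < t → 4 * t ≤ 1 → G (4 * t) ≤ G (2 * t) + K * (ENNReal.ofReal (t ^ a) * S t))
    {L : ℕ} {B : ℝ≥0∞} (hB : 2 ^ L * G (4 / (2 ^ L : ℕ)) ^ α ≤ B * S (1 / (2 ^ L : ℕ)) ^ α)
    (hL : 2 ≤ L) {j : ℕ} (hj0 : j ≠ 0) (hj : j ≤ 2 ^ L) :
    j * S (j / (2 ^ L : ℕ)) ^ α + 2 ^ L * G (j / (2 ^ L : ℕ)) ^ α ≤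
      (1 + (B + ENNReal.ofReal α * (2 * ((D * (D * D)) ^ (α - 1) * K)))) *
        ∑ i ∈ Finset.range j, gridValue S G a α (2 ^ L) i := by
  have hN0 : (0 : ℝ) < (2 ^ L : ℕ) := by positivity
  have h1 : j * S (j / (2 ^ L : ℕ)) ^ α ≤ ∑ i ∈ Finset.range j, gridValue S G a α (2 ^ L) i := by
    have := Finset.card_nsmul_le_sum (Finset.range j) (fun i => gridValue S G a α (2 ^ L) i)
      (S (j / (2 ^ L : ℕ)) ^ α) fun i hi => ?_
    · rwa [Finset.card_range, nsmul_eq_mul] at this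
    · refine le_trans (ENNReal.rpow_le_rpow (hS ?_ ?_ ?_) (by linarith)) le_self_add
      · exact div_pos (by positivity) hN0
      · exact div_pos (by exact_mod_cast Nat.pos_of_ne_zero hj0) hN0
      · gcongr
        exact_mod_cast Finset.mem_range.1 hi
  have hex : ∃ p, j ≤ 2 ^ (p + 2) := ⟨j, (Nat.lt_two_pow_self).le.trans
    (pow_le_pow_right₀ one_le_two (by omega))⟩
  classical
  set p := Nat.find hex with hp
  have hp1 : j ≤ 2 ^ (p + 2) := Nat.find_spec hex
  have hp2 : p + 2 ≤ L ∧ 2 ^ p ≤ j := by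
    rcases Nat.eq_zero_or_pos p with h | h
    · rw [h]
      exact ⟨hL, by rw [pow_zero]; exact Nat.one_le_iff_ne_zero.2 hj0⟩
    · have h2 : 2 ^ (p - 1 + 2) < j := not_le.1 (Nat.find_min hex (Nat.sub_lt h one_pos))
      have h3 : p - 1 + 2 < L := (Nat.pow_lt_pow_iff_right (by norm_num)).1 (h2.trans_le hj)
      exact ⟨by omega, (pow_le_pow_right₀ one_le_two (by omega)).trans h2.le⟩
  have h2 : 2 ^ L * G (j / (2 ^ L : ℕ)) ^ α ≤ 2 ^ L * G (2 ^ (p + 2) / (2 ^ L : ℕ)) ^ α := by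
    refine mul_le_mul' le_rfl (ENNReal.rpow_le_rpow (hG ?_ ?_ ?_) (by linarith))
    · simp; positivity
    · simp; positivity
    · gcongr
      exact_mod_cast hp1
  rw [add_mul, one_mul]
  refine add_le_add h1 (h2.trans ((mul_rpow_le_sum_gridValue_pow ha haα hα hS hG hGt hD hK hB p
    hp2.1).trans (mul_le_mul' le_rfl ?_)))
  exact Finset.sum_le_sum_of_subset (Finset.range_subset_range.2 hp2.2)

end Grid

theorem sum_mul_nonneg_of_antitone {c x : ℕ → ℝ} (hc : Antitone c) (hc0 : ∀ i, 0 ≤ c i) {N : ℕ}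
    (hx : ∀ j ≤ N, 0 ≤ ∑ i ∈ Finset.range j, x i) :
    0 ≤ ∑ i ∈ Finset.range N, c i * x i := by
  suffices h : ∀ j ≤ N, c j * ∑ i ∈ Finset.range j, x i ≤ ∑ i ∈ Finset.range j, c i * x i from
    (mul_nonneg (hc0 N) (hx N le_rfl)).trans (h N le_rfl)
  intro j
  induction j with
  | zero => simp
  | succ j ih =>
    intro hj
    rw [Finset.sum_range_succ (fun i => c i * x i)]
    have h1 := mul_le_mul_of_nonneg_right (hc j.le_succ) (hx (j + 1) hj)
    rw [Finset.sum_range_succ, mul_add (c j)] at h1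
    have h2 := ih (by omega)
    rw [Finset.sum_range_succ]
    linarith

/-- A symmetric sublinear functional vanishing on the negative cone respects weak majorization. -/
theorem le_of_sublinear_of_sum_le {N : ℕ} {p : (Fin N → ℝ) → ℝ}
    (hp0 : ∀ v, v ≤ 0 → p v = 0) (hp : ∀ v, 0 ≤ p v)
    (hsmul : ∀ (c : ℝ), 0 < c → ∀ v, p (c • v) = c * p v) (hadd : ∀ v w, p (v + w) ≤ p v + p w)
    (hsymm : ∀ (σ : Equiv.Perm (Fin N)) v, p (v ∘ σ) = p v) {h k : ℕ → ℝ} (hh : Antitone h)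
    (hhk : ∀ j ≤ N, ∑ i ∈ Finset.range j, h i ≤ ∑ i ∈ Finset.range j, k i) :
    p (fun i => h i) ≤ p (fun i => k i) := by
  set v : Fin N → ℝ := fun i => h i with hv
  by_cases hv0 : v = 0
  · rw [hv0, hp0 0 le_rfl]
    exact hp _
  obtain ⟨φ, hφ, hφp⟩ := exists_extension_of_le_sublinear
    (LinearPMap.mkSpanSingleton (K := ℝ) v (p v) hv0) p hsmul hadd (by
      rintro ⟨x, hx⟩
      obtain ⟨c, rfl⟩ := Submodule.mem_span_singleton.1 hx
      rw [LinearPMap.mkSpanSingleton'_apply]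
      rcases lt_trichotomy c 0 with hc | rfl | hc
      · exact (smul_nonpos_of_nonpos_of_nonneg hc.le (hp v)).trans (hp _)
      · simp [hp]
      · simp [hsmul c hc])
  have hφv : φ v = p v := by
    have := hφ ⟨v, Submodule.mem_span_singleton_self v⟩
    rwa [LinearPMap.mkSpanSingleton_apply] at this
  set c : Fin N → ℝ := fun i => φ (Pi.single i 1) with hc
  have hφc : ∀ w, φ w = ∑ i, c i * w i := fun w => by
    rw [φ.pi_apply_eq_sum_univ w]
    refine Finset.sum_congr rfl fun i _ => ?_
    rw [smul_eq_mul, mul_comm]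
    congr 2
    ext j
    simp [Pi.single_apply, eq_comm]
  have hc0 : ∀ i, 0 ≤ c i := fun i => by
    have h1 := hφp (-Pi.single i 1)
    rw [hp0 _ (by simp), map_neg] at h1
    simpa using h1
  set σ : Equiv.Perm (Fin N) := Tuple.sort (fun i => -c i) with hσ
  have hcσ : Antitone (c ∘ σ) := by
    have := Tuple.monotone_sort (fun i => -c i)
    intro i j hij
    simpa using this hij
  have hvσ : Antitone v := fun i j hij => hh hij
  have h1 : ∑ i, c i * v i ≤ ∑ i, c (σ i) * v i := by
    have := (hcσ.monovary hvσ).sum_comp_perm_mul_le_sum_mul (σ := σ⁻¹)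
    simpa using this
  have h2 : ∑ i, c (σ i) * v i ≤ ∑ i, c (σ i) * k i := by
    set c' : ℕ → ℝ := fun i => if hi : i < N then c (σ ⟨i, hi⟩) else 0 with hc'
    have := sum_mul_nonneg_of_antitone (c := c') (x := fun i => k i - h i) (N := N) ?_ ?_ ?_
    · rw [← Fin.sum_univ_eq_sum_range (fun i => c' i * (k i - h i))] at this
      simp only [hc', Fin.is_lt, dite_true, mul_sub, Finset.sum_sub_distrib, Fin.eta] at this
      linarith
    · intro i j hij
      simp only [hc']
      split_ifs with hj hi hi
      · exact hcσ (Fin.mk_le_mk.2 hij)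
      · omega
      · exact hc0 _
      · rfl
    · intro i
      simp only [hc']
      split_ifs
      · exact hc0 _
      · rfl
    · intro j hj
      rw [Finset.sum_sub_distrib]
      linarith [hhk j hj]
  have h3 : ∑ i, c (σ i) * k i = φ ((fun i : Fin N => k i) ∘ σ.symm) := by
    rw [hφc, ← Equiv.sum_comp σ (fun i => c i * _)]
    simp
  calc p v = ∑ i, c i * v i := by rw [← hφv, hφc]
    _ ≤ φ ((fun i : Fin N => k i) ∘ σ.symm) := h1.trans (h2.trans h3.le)
    _ ≤ p ((fun i : Fin N => k i) ∘ σ.symm) := hφp _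
    _ = _ := hsymm _ _

section Cells

variable {N : ℕ} [NeZero N]

/-- The index of the cell of the uniform partition of `[0,1)` into `N` cells containing `t`. -/
noncomputable def cellIndex (N : ℕ) [NeZero N] (t : ℝ) : Fin N := Fin.ofNat N ⌊(N : ℝ) * t⌋₊

theorem measurable_cellIndex : Measurable (cellIndex N) :=
  measurable_from_top.comp (Nat.measurable_floor.comp (measurable_const_mul _))

theorem coe_cellIndex {t : ℝ} (ht : t ∈ Ico 0 1) : (cellIndex N t : ℕ) = ⌊(N : ℝ) * t⌋₊ := by
  have hN : (0 : ℝ) < N := by exact_mod_cast NeZero.pos N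
  refine Nat.mod_eq_of_lt ?_
  rw [Nat.floor_lt (mul_nonneg hN.le ht.1)]
  nlinarith [ht.2]

theorem vol01_preimage_cellIndex (i : Fin N) :
    vol01 (cellIndex N ⁻¹' {i}) = ENNReal.ofReal (1 / N) := by
  have hN : (0 : ℝ) < N := by exact_mod_cast NeZero.pos N
  rw [vol01, restrict_Ioo_eq_restrict_Ico, Measure.restrict_apply
    (measurable_cellIndex (measurableSet_singleton i))]
  have : cellIndex N ⁻¹' {i} ∩ Ico 0 1 = Ico ((i : ℝ) / N) (((i : ℝ) + 1) / N) := by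
    have hi : (i : ℝ) + 1 ≤ N := by exact_mod_cast i.2
    ext t
    constructor
    · rintro ⟨h, ht⟩
      rw [mem_preimage, mem_singleton_iff, Fin.ext_iff, coe_cellIndex ht,
        Nat.floor_eq_iff (mul_nonneg hN.le ht.1)] at h
      exact ⟨(div_le_iff₀' hN).2 h.1, (lt_div_iff₀' hN).2 h.2⟩
    · rintro ⟨h1, h2⟩
      have ht : t ∈ Ico (0 : ℝ) 1 := ⟨le_trans (by positivity) h1,
        h2.trans_le ((div_le_one hN).2 hi)⟩
      refine ⟨?_, ht⟩
      rw [mem_preimage, mem_singleton_iff, Fin.ext_iff, coe_cellIndex ht,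
        Nat.floor_eq_iff (mul_nonneg hN.le ht.1)]
      exact ⟨(div_le_iff₀' hN).1 h1, (lt_div_iff₀' hN).1 h2⟩
  rw [this, Real.volume_Ico]
  congr 1
  ring

theorem decRearr_comp_cellIndex_perm (v : Fin N → ℝ≥0∞) (σ : Equiv.Perm (Fin N)) :
    decRearr (fun t => v (σ (cellIndex N t))) = decRearr (fun t => v (cellIndex N t)) := by
  classical
  have key : ∀ (w : Fin N → ℝ≥0∞) ρ, vol01 {t | ρ < w (cellIndex N t)} =
      (Finset.univ.filter (fun i => ρ < w i)).card • ENNReal.ofReal (1 / N) := fun w ρ => by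
    rw [← Finset.sum_const, ← Finset.sum_congr rfl fun i _ => vol01_preimage_cellIndex i,
      sum_measure_preimage_singleton _ fun i _ => measurable_cellIndex (measurableSet_singleton i)]
    congr 1
    ext t
    simp
  funext s
  rw [decRearr, decRearr]
  congr 1
  ext ρ
  rw [mem_ofPred_eq, mem_ofPred_eq, key (fun i => v (σ i)), key v]
  congr! 2
  exact Finset.card_equiv σ fun i => by simp

theorem IsRINorm.comp_cellIndex_lt_top {Z : (ℝ → ℝ≥0∞) → ℝ≥0∞} (hZ : IsRINorm Z)
    {v : Fin N → ℝ≥0∞} (hv : ∀ i, v i ≠ ⊤) : Z (fun t => v (cellIndex N t)) < ⊤ := by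
  have h1 : (∑ i, v i) ≠ ⊤ := ENNReal.sum_ne_top.2 fun i _ => hv i
  lift ∑ i, v i to ℝ≥0 using h1 with c hc
  refine lt_of_le_of_lt (hZ.mono _ (fun t => c * (Ioo (0 : ℝ) 1).indicator 1 t) ?_) ?_
  · refine (ae_restrict_iff' measurableSet_Ioo).2 (.of_forall fun t ht => ?_)
    rw [indicator_of_mem ht, Pi.one_apply, mul_one, hc]
    exact Finset.single_le_sum (fun _ _ => zero_le) (Finset.mem_univ _)
  · rw [hZ.smul]
    exact ENNReal.mul_lt_top ENNReal.coe_lt_top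
      (hZ.indicator_lt_top _ measurableSet_Ioo Subset.rfl)

/-- Hardy-Littlewood-Pólya principle for functions which are constant on each cell. -/
theorem IsRINorm.floor_le_of_sum_le {Z : (ℝ → ℝ≥0∞) → ℝ≥0∞} (hZ : IsRINorm Z) {h k : ℕ → ℝ≥0∞}
    (hh : Antitone h) (hht : ∀ i, h i ≠ ⊤) (hkt : ∀ i, k i ≠ ⊤)
    (hhk : ∀ j ≤ N, ∑ i ∈ Finset.range j, h i ≤ ∑ i ∈ Finset.range j, k i) :
    Z (fun t => h ⌊(N : ℝ) * t⌋₊) ≤ Z (fun t => k ⌊(N : ℝ) * t⌋₊) := by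
  have hlt : ∀ v : Fin N → ℝ, Z (fun t => ENNReal.ofReal (v (cellIndex N t))) ≠ ⊤ := fun v =>
    (hZ.comp_cellIndex_lt_top (v := fun i => ENNReal.ofReal (v i))
      fun _ => ENNReal.ofReal_ne_top).ne
  have hcongr : ∀ w : ℕ → ℝ≥0∞, (∀ i, w i ≠ ⊤) → Z (fun t => w ⌊(N : ℝ) * t⌋₊) =
      Z (fun t => ENNReal.ofReal ((w (cellIndex N t)).toReal)) := fun w hw => by
    have h1 : ∀ᵐ t ∂vol01, w ⌊(N : ℝ) * t⌋₊ = ENNReal.ofReal ((w (cellIndex N t)).toReal) := by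
      refine (ae_restrict_iff' measurableSet_Ioo).2 (.of_forall fun t ht => ?_)
      rw [coe_cellIndex ⟨ht.1.le, ht.2⟩, ENNReal.ofReal_toReal (hw _)]
    exact le_antisymm (hZ.mono _ _ (h1.mono fun t ht => ht.le))
      (hZ.mono _ _ (h1.mono fun t ht => ht.ge))
  rw [hcongr h hht, hcongr k hkt, ← ENNReal.toReal_le_toReal (hlt fun i => (h i).toReal)
    (hlt fun i => (k i).toReal)]
  refine le_of_sublinear_of_sum_le
    (p := fun v : Fin N → ℝ => (Z fun t => ENNReal.ofReal (v (cellIndex N t))).toReal)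
    (h := fun i => (h i).toReal) (k := fun i => (k i).toReal) (fun v hv => ?_)
    (fun v => ENNReal.toReal_nonneg) (fun c hc v => ?_) (fun v w => ?_) (fun σ v => ?_)
    (fun i j hij => ENNReal.toReal_mono (hht i) (hh hij)) fun j hj => ?_
  · have : Z (fun t => ENNReal.ofReal (v (cellIndex N t))) = 0 :=
      (hZ.eq_zero_iff _).2 (.of_forall fun t => ENNReal.ofReal_of_nonpos (hv _))
    simp [this]
  · have := hZ.smul c.toNNReal (fun t => ENNReal.ofReal (v (cellIndex N t)))
    simp only [Pi.smul_apply, smul_eq_mul, ENNReal.ofReal_mul hc.le]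
    rw [ENNReal.ofReal, this, ENNReal.toReal_mul, ENNReal.coe_toReal, Real.coe_toNNReal _ hc.le]
  · rw [← ENNReal.toReal_add (hlt v) (hlt w)]
    refine ENNReal.toReal_mono (ENNReal.add_ne_top.2 ⟨hlt v, hlt w⟩) ((hZ.mono _ _ ?_).trans
      (hZ.add_le _ _))
    exact .of_forall fun t => ENNReal.ofReal_add_le
  · exact congrArg _ (hZ.rearr_invariant _ _ (decRearr_comp_cellIndex_perm
      (fun i => ENNReal.ofReal (v i)) σ))
  · rw [← ENNReal.toReal_sum fun i _ => hht i, ← ENNReal.toReal_sum fun i _ => hkt i]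
    exact ENNReal.toReal_mono (ENNReal.sum_ne_top.2 fun i _ => hkt i) (hhk j hj)

end Cells

/-- The outer integral `∫_{t^κ}^1 s^(b-1) f(s) ds`. -/
noncomputable def outerInt (κ b : ℝ) (f : ℝ → ℝ≥0∞) (t : ℝ) : ℝ≥0∞ :=
  ∫⁻ s in Ioo (t ^ κ) 1, ENNReal.ofReal (s ^ (b - 1)) * f s

/-- The inner integral `∫_0^{t^κ} s^(a-1) f(s) ds`. -/
noncomputable def innerInt (κ a : ℝ) (f : ℝ → ℝ≥0∞) (t : ℝ) : ℝ≥0∞ :=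
  ∫⁻ s in Ioo 0 (t ^ κ), ENNReal.ofReal (s ^ (a - 1)) * f s

section Operators

variable {f : ℝ → ℝ≥0∞} {κ a b : ℝ}

theorem antitoneOn_outerInt (hκ : 0 < κ) : AntitoneOn (outerInt κ b f) (Ioi 0) :=
  fun _ hx _ _ hxy => lintegral_mono_set
    (Ioo_subset_Ioo_left (Real.rpow_le_rpow (mem_Ioi.1 hx).le hxy hκ.le))

theorem monotoneOn_innerInt (hκ : 0 < κ) : MonotoneOn (innerInt κ a f) (Ici 0) :=
  fun _ hx _ _ hxy => lintegral_mono_set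
    (Ioo_subset_Ioo_right (Real.rpow_le_rpow (mem_Ici.1 hx) hxy hκ.le))

theorem innerInt_ne_top (hf : Antitone f) (hf0 : f 0 ≠ ⊤) (ha : 0 < a) (t : ℝ) :
    innerInt κ a f t ≠ ⊤ := by
  rcases le_total 0 (t ^ κ) with h | h
  · exact ne_top_of_le_ne_top (ENNReal.mul_ne_top ENNReal.ofReal_ne_top hf0)
      (lintegral_Ioo_rpow_mul_le hf ha le_rfl h)
  · simp [innerInt, Ioo_eq_empty_of_le h]

theorem outerInt_ne_top (hf : Antitone f) (hf0 : f 0 ≠ ⊤) (hb : 0 < b) {t : ℝ} (ht : 0 < t) :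
    outerInt κ b f t ≠ ⊤ := by
  have h0 : 0 ≤ t ^ κ := by positivity
  rcases le_total (t ^ κ) 1 with h | h
  · exact ne_top_of_le_ne_top (ENNReal.mul_ne_top ENNReal.ofReal_ne_top
      (ne_top_of_le_ne_top hf0 (hf h0))) (lintegral_Ioo_rpow_mul_le hf hb h0 h)
  · simp [outerInt, Ioo_eq_empty_of_le h]

theorem innerInt_two_mul_le (hf : Antitone f) (hκ : 0 < κ) (ha : 0 < a) {t : ℝ} (ht : 0 < t) :
    innerInt κ a f (2 * t) ≤ (1 + ENNReal.ofReal (2 ^ (κ * a))) * innerInt κ a f t := by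
  have h0 : 0 < t ^ κ := by positivity
  have hle : t ^ κ ≤ (2 * t) ^ κ := Real.rpow_le_rpow ht.le (by linarith) hκ.le
  refine (lintegral_Ioo_le_add _ h0.le hle).trans ?_
  rw [add_mul, one_mul]
  refine add_le_add le_rfl ((lintegral_Ioo_rpow_mul_le hf ha h0.le hle).trans ?_)
  refine le_trans ?_ (mul_le_mul' le_rfl (le_lintegral_Ioo_rpow_mul hf ha le_rfl h0.le))
  rw [← mul_assoc, ← ENNReal.ofReal_mul (by positivity)]
  refine mul_le_mul' (ENNReal.ofReal_le_ofReal ?_) le_rfl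
  rw [Real.zero_rpow ha.ne', Real.mul_rpow (by norm_num) ht.le,
    Real.mul_rpow (by positivity) h0.le, ← Real.rpow_mul (by norm_num), sub_zero, mul_div_assoc']
  gcongr
  have : 0 ≤ (t ^ κ) ^ a := by positivity
  linarith

theorem innerInt_four_mul_le (hf : Antitone f) (hκ : 0 < κ) (ha : 0 < a) (hb : 0 < b)
    (hab : κ * a = a + κ * b) {t : ℝ} (ht : 0 < t) (ht1 : 4 * t ≤ 1) :
    innerInt κ a f (4 * t) ≤ innerInt κ a f (2 * t) +
      ENNReal.ofReal ((4 ^ (κ * a) - 2 ^ (κ * a)) / a * (b / (2 ^ (κ * b) - 1))) *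
        (ENNReal.ofReal (t ^ a) * outerInt κ b f t) := by
  have h0 : 0 < t ^ κ := by positivity
  have h20 : 0 < (2 * t) ^ κ := by positivity
  have hle : t ^ κ ≤ (2 * t) ^ κ := Real.rpow_le_rpow ht.le (by linarith) hκ.le
  have hle' : (2 * t) ^ κ ≤ (4 * t) ^ κ := Real.rpow_le_rpow (by linarith) (by linarith) hκ.le
  have h21 : (2 * t) ^ κ ≤ 1 := Real.rpow_le_one (by linarith) (by linarith) hκ.le
  have h2b : (1 : ℝ) < 2 ^ (κ * b) := Real.one_lt_rpow (by norm_num) (by positivity)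
  have h42 : (2 : ℝ) ^ (κ * a) ≤ 4 ^ (κ * a) :=
    Real.rpow_le_rpow (by norm_num) (by norm_num) (by positivity)
  refine (lintegral_Ioo_le_add _ h20.le hle').trans (add_le_add le_rfl
    ((lintegral_Ioo_rpow_mul_le hf ha h20.le hle').trans ?_))
  have hS : ENNReal.ofReal ((((2 * t) ^ κ) ^ b - (t ^ κ) ^ b) / b) * f ((2 * t) ^ κ) ≤
      outerInt κ b f t := (le_lintegral_Ioo_rpow_mul hf hb h0.le hle).trans
    (lintegral_mono_set (Ioo_subset_Ioo_right h21))
  refine le_trans (le_of_eq ?_) (mul_le_mul' le_rfl (mul_le_mul' le_rfl hS))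
  rw [← mul_assoc, ← mul_assoc, ← ENNReal.ofReal_mul (by
    have := sub_pos.2 h2b
    have := sub_nonneg.2 h42
    positivity), ← ENNReal.ofReal_mul (by
    have := sub_pos.2 h2b
    have := sub_nonneg.2 h42
    positivity)]
  congr 2
  rw [← Real.rpow_mul (by positivity), ← Real.rpow_mul (by positivity),
    ← Real.rpow_mul (by positivity), ← Real.rpow_mul (by positivity),
    Real.mul_rpow (by norm_num) ht.le, Real.mul_rpow (by norm_num) ht.le,
    Real.mul_rpow (by norm_num) ht.le]
  have : t ^ (κ * a) = t ^ a * t ^ (κ * b) := by rw [hab, Real.rpow_add ht]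
  rw [this]
  have := (sub_pos.2 h2b).ne'
  field_simp

theorem eventually_two_pow_mul_innerInt_rpow_le (hf : Antitone f) (hf0 : f 0 ≠ ⊤) (hκ : 0 < κ)
    (ha : 0 < a) (hb : 0 < b) (hab : κ * a = a + κ * b) {α : ℝ} (haα : a * α = 1) (hα : 1 < α) :
    ∀ᶠ L : ℕ in Filter.atTop, 2 ^ L * innerInt κ a f (4 / (2 ^ L : ℕ)) ^ α ≤
      4 * outerInt κ b f (1 / (2 ^ L : ℕ)) ^ α := by
  have hα0 : 0 < α := by linarith
  have hlim : Filter.Tendsto (fun L : ℕ => (1 : ℝ) / (2 ^ L : ℕ)) Filter.atTop (nhds 0) := by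
    have := tendsto_pow_atTop_nhds_zero_of_lt_one (r := (1 / 2 : ℝ)) (by norm_num) (by norm_num)
    refine this.congr fun L => ?_
    push_cast
    rw [div_pow, one_pow]
  by_cases hS : ∃ t, 0 < t ∧ outerInt κ b f t ≠ 0
  · obtain ⟨t, ht, hSt⟩ := hS
    have hlim4 : Filter.Tendsto (fun L : ℕ => ENNReal.ofReal ((4 / (2 ^ L : ℕ) : ℝ) ^ (κ * b) / a) *
        f 0) Filter.atTop (nhds 0) := by
      have h1 : Filter.Tendsto (fun L : ℕ => (4 / (2 ^ L : ℕ) : ℝ)) Filter.atTop (nhds 0) := by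
        have := hlim.const_mul 4
        simpa [div_eq_mul_inv] using this
      have h2 := (h1.rpow_const (p := κ * b) (Or.inr (by positivity))).div_const a
      rw [Real.zero_rpow (by positivity), zero_div] at h2
      have h3 := ENNReal.Tendsto.mul_const (ENNReal.tendsto_ofReal h2) (Or.inr hf0)
      simpa using h3
    filter_upwards [hlim4.eventually_le_const (pos_iff_ne_zero.2 hSt),
      hlim.eventually_le_const ht] with L h1 h2
    have hN : (0 : ℝ) < (2 ^ L : ℕ) := by positivity
    set τ : ℝ := 4 / (2 ^ L : ℕ) with hτ
    have hτ0 : 0 < τ := by positivity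
    have h3 : innerInt κ a f τ ≤ ENNReal.ofReal (τ ^ a) * outerInt κ b f (1 / (2 ^ L : ℕ)) := by
      refine (lintegral_Ioo_rpow_mul_le hf ha le_rfl (by positivity)).trans ?_
      refine le_trans (le_of_eq ?_) (mul_le_mul' le_rfl (h1.trans
        (antitoneOn_outerInt hκ (by simp) ht h2)))
      rw [← mul_assoc, ← ENNReal.ofReal_mul (by positivity), Real.zero_rpow ha.ne', sub_zero,
        ← Real.rpow_mul hτ0.le, hab, Real.rpow_add hτ0]
      congr 2
      ring
    refine (mul_le_mul' le_rfl (ENNReal.rpow_le_rpow h3 hα0.le)).trans (le_of_eq ?_)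
    rw [ENNReal.mul_rpow_of_nonneg _ _ hα0.le, ENNReal.ofReal_rpow_of_nonneg (by positivity)
      hα0.le, ← Real.rpow_mul hτ0.le, haα, Real.rpow_one, ← mul_assoc]
    congr 1
    have : (2 : ℝ≥0∞) ^ L = ENNReal.ofReal (2 ^ L : ℕ) := by
      rw [ENNReal.ofReal_natCast]; push_cast; rfl
    rw [this, ← ENNReal.ofReal_mul hN.le, hτ, mul_div_cancel₀ _ hN.ne']
    norm_num
  · push Not at hS
    have hfz : ∀ y ∈ Ioo (0 : ℝ) 1, f y = 0 := by
      intro y hy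
      have hp : 0 < y / 2 := by linarith [hy.1]
      have h1 := hS ((y / 2) ^ κ⁻¹) (by positivity)
      have h2 : ENNReal.ofReal ((y ^ b - (y / 2) ^ b) / b) * f y ≤ 0 := by
        rw [← h1, outerInt, Real.rpow_inv_rpow hp.le hκ.ne']
        exact (le_lintegral_Ioo_rpow_mul hf hb hp.le (by linarith)).trans
          (lintegral_mono_set (Ioo_subset_Ioo_right hy.2.le))
      refine (mul_eq_zero.1 (nonpos_iff_eq_zero.1 h2)).resolve_left ?_
      have : (y / 2) ^ b < y ^ b := Real.rpow_lt_rpow hp.le (by linarith) hb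
      have := sub_pos.2 this
      exact (ENNReal.ofReal_pos.2 (by positivity)).ne'
    filter_upwards [hlim.eventually_le_const (show (0 : ℝ) < 1 / 4 by norm_num)] with L hL
    have hG : innerInt κ a f (4 / (2 ^ L : ℕ)) = 0 := by
      have h4 : (4 / (2 ^ L : ℕ) : ℝ) ≤ 1 := by
        rw [div_eq_mul_one_div]; linarith
      have h5 : (4 / (2 ^ L : ℕ) : ℝ) ^ κ ≤ 1 := Real.rpow_le_one (by positivity) h4 hκ.le
      rw [innerInt, setLIntegral_congr_fun (g := 0) measurableSet_Ioo fun s hs => by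
        simp [hfz s ⟨hs.1, hs.2.trans_le h5⟩]]
      simp
    rw [hG, ENNReal.zero_rpow_of_pos hα0, mul_zero]
    exact zero_le

end Operators

theorem sum_mul_ofReal_le_lintegral_Ioo {h : ℝ → ℝ≥0∞} (hh : Antitone h) (N j : ℕ) :
    (∑ i ∈ Finset.range j, h (((i : ℝ) + 1) / N)) * ENNReal.ofReal (1 / N) ≤
      ∫⁻ s in Ioo (0 : ℝ) (j / N), h s := by
  simp_rw [restrict_Ioo_eq_restrict_Ioc]
  induction j with
  | zero => simp
  | succ j ih =>
    have h1 : (j : ℝ) / N ≤ ((j + 1 : ℕ) : ℝ) / N := by gcongr; exact j.le_succ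
    rw [← Ioc_union_Ioc_eq_Ioc (by positivity) h1, lintegral_union measurableSet_Ioc
      (disjoint_left.2 fun x hx hx' => not_lt.2 hx.2 hx'.1), Finset.sum_range_succ, add_mul]
    refine add_le_add ih ?_
    have h2 : h (((j : ℝ) + 1) / N) * ENNReal.ofReal (1 / N) =
        ∫⁻ _ in Ioc ((j : ℝ) / N) (((j + 1 : ℕ) : ℝ) / N), h (((j : ℝ) + 1) / N) := by
      rw [setLIntegral_const, Real.volume_Ioc]
      congr 2
      push_cast
      ring
    rw [h2]
    refine setLIntegral_mono' measurableSet_Ioc fun s hs => hh ?_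
    have := hs.2
    push_cast at this
    exact this

theorem gridValue_floor_le {S G : ℝ → ℝ≥0∞} {a α : ℝ} (ha : 0 < a) (hα : 1 < α)
    (hS : AntitoneOn S (Ioi 0)) (hG : MonotoneOn G (Ici 0)) {N : ℕ} (hN : N ≠ 0) {t : ℝ}
    (ht : 0 < t) :
    gridValue S G a α N ⌊(N : ℝ) * t⌋₊ ≤
      S t ^ α + S t * (ENNReal.ofReal (t ^ (-a)) * G t) ^ (α - 1) := by
  have hN0 : (0 : ℝ) < N := by exact_mod_cast Nat.pos_of_ne_zero hN
  have h1 : t ≤ ((⌊(N : ℝ) * t⌋₊ : ℝ) + 1) / N :=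
    (le_div_iff₀' hN0).2 (Nat.lt_floor_add_one _).le
  have h2 : (⌊(N : ℝ) * t⌋₊ : ℝ) / N ≤ t :=
    (div_le_iff₀' hN0).2 (Nat.floor_le (by positivity))
  have hSt := hS ht (ht.trans_le h1) h1
  refine add_le_add (ENNReal.rpow_le_rpow hSt (by linarith)) (mul_le_mul' hSt
    (ENNReal.rpow_le_rpow (mul_le_mul' (ENNReal.ofReal_le_ofReal
      (Real.rpow_le_rpow_of_nonpos ht h1 (by linarith))) (hG ?_ ht.le h2)) (by linarith)))
  exact mem_Ici.2 (by positivity)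

theorem iSup_dyadic_floor_eq {h : ℝ → ℝ≥0∞} (hh : Antitone h) {t : ℝ} (ht : 0 ≤ t)
    (hc : ContinuousAt h t) (M : ℕ) :
    ⨆ L : ℕ, h (((⌊((2 ^ (M + L) : ℕ) : ℝ) * t⌋₊ : ℝ) + 1) / (2 ^ (M + L) : ℕ)) = h t := by
  refine le_antisymm (iSup_le fun L => hh ?_) ?_
  · rw [le_div_iff₀' (by positivity)]
    exact (Nat.lt_floor_add_one _).le
  · refine le_of_tendsto' (x := Filter.atTop) (hc.tendsto.comp
      (f := fun L : ℕ => ((⌊((2 ^ (M + L) : ℕ) : ℝ) * t⌋₊ : ℝ) + 1) / (2 ^ (M + L) : ℕ)) ?_)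
      fun L => le_iSup (fun L : ℕ => h (((⌊((2 ^ (M + L) : ℕ) : ℝ) * t⌋₊ : ℝ) + 1) /
        (2 ^ (M + L) : ℕ))) L
    have h1 : Filter.Tendsto (fun L : ℕ => ((2 ^ (M + L) : ℕ) : ℝ)) Filter.atTop Filter.atTop :=
      tendsto_natCast_atTop_atTop.comp ((tendsto_pow_atTop_atTop_of_one_lt one_lt_two).comp
        (Filter.tendsto_add_atTop_nat M |>.congr fun L => by rw [add_comm]))
    have h2 : Filter.Tendsto (fun L : ℕ => t + 1 / ((2 ^ (M + L) : ℕ) : ℝ)) Filter.atTop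
        (nhds t) := by
      simpa using tendsto_const_nhds.add (h1.inv_tendsto_atTop)
    refine tendsto_of_tendsto_of_tendsto_of_le_of_le tendsto_const_nhds h2 (fun L => ?_)
      fun L => ?_
    · show t ≤ _
      rw [le_div_iff₀' (by positivity)]
      exact (Nat.lt_floor_add_one _).le
    · show _ ≤ t + 1 / ((2 ^ (M + L) : ℕ) : ℝ)
      rw [add_div]
      gcongr
      rw [div_le_iff₀' (by positivity)]
      exact Nat.floor_le (by positivity)

theorem dyadic_floor_mono {h : ℝ → ℝ≥0∞} (hh : Antitone h) {t : ℝ} (ht : 0 ≤ t) (L : ℕ) :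
    h (((⌊((2 ^ L : ℕ) : ℝ) * t⌋₊ : ℝ) + 1) / (2 ^ L : ℕ)) ≤
      h (((⌊((2 ^ (L + 1) : ℕ) : ℝ) * t⌋₊ : ℝ) + 1) / (2 ^ (L + 1) : ℕ)) := by
  apply hh
  rw [div_le_div_iff₀ (by positivity) (by positivity)]
  have h1 : ⌊((2 ^ (L + 1) : ℕ) : ℝ) * t⌋₊ < 2 * (⌊((2 ^ L : ℕ) : ℝ) * t⌋₊ + 1) := by
    rw [Nat.floor_lt (by positivity)]
    have := Nat.lt_floor_add_one (((2 ^ L : ℕ) : ℝ) * t)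
    push_cast at this ⊢
    rw [pow_succ]
    linarith
  have h2 : (⌊((2 ^ (L + 1) : ℕ) : ℝ) * t⌋₊ : ℝ) + 1 ≤ 2 * (⌊((2 ^ L : ℕ) : ℝ) * t⌋₊ + 1) := by
    exact_mod_cast h1
  calc _ ≤ 2 * ((⌊((2 ^ L : ℕ) : ℝ) * t⌋₊ : ℝ) + 1) * (2 ^ L : ℕ) := by gcongr
    _ = _ := by push_cast; rw [pow_succ]; ring

theorem IsRINorm.eq_iSup_dyadic {Z : (ℝ → ℝ≥0∞) → ℝ≥0∞} (hZ : IsRINorm Z) {h : ℝ → ℝ≥0∞}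
    (hh : Antitone h) (M : ℕ) :
    Z h = ⨆ L : ℕ, Z fun t =>
      h (((⌊((2 ^ (M + L) : ℕ) : ℝ) * t⌋₊ : ℝ) + 1) / (2 ^ (M + L) : ℕ)) := by
  refine hZ.iSup_eq _ _ (fun L => ?_) ?_
  · exact (ae_restrict_iff' measurableSet_Ioo).2
      (.of_forall fun t ht => dyadic_floor_mono hh ht.1.le (M + L))
  · have h1 : ∀ᵐ t : ℝ, ContinuousAt h t :=
      (hh.countable_not_continuousAt).ae_notMem _ |>.mono fun t ht => not_not.1 ht
    refine (ae_restrict_iff' measurableSet_Ioo).2 (h1.mono fun t hc ht => ?_)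
    exact iSup_dyadic_floor_eq hh ht.1.le hc M

/-- The constant comparing sums of a function controlled on average with grid sums. -/
noncomputable def gridConst (κ a b α : ℝ) : ℝ≥0∞ :=
  1 + (4 + ENNReal.ofReal α * (2 * (((1 + ENNReal.ofReal (2 ^ (κ * a))) *
    ((1 + ENNReal.ofReal (2 ^ (κ * a))) * (1 + ENNReal.ofReal (2 ^ (κ * a))))) ^ (α - 1) *
      ENNReal.ofReal ((4 ^ (κ * a) - 2 ^ (κ * a)) / a * (b / (2 ^ (κ * b) - 1))))))

section Comparison

variable {f : ℝ → ℝ≥0∞} {κ a b α : ℝ}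

theorem gridConst_ne_top (hα : 1 < α) : gridConst κ a b α ≠ ⊤ := by
  have h1 : (1 + ENNReal.ofReal (2 ^ (κ * a))) ≠ ⊤ :=
    ENNReal.add_ne_top.2 ⟨ENNReal.one_ne_top, ENNReal.ofReal_ne_top⟩
  have h2 := ENNReal.rpow_ne_top_of_nonneg (by linarith : 0 ≤ α - 1)
    (ENNReal.mul_ne_top h1 (ENNReal.mul_ne_top h1 h1))
  exact ENNReal.add_ne_top.2 ⟨ENNReal.one_ne_top, ENNReal.add_ne_top.2 ⟨by norm_num,
    ENNReal.mul_ne_top ENNReal.ofReal_ne_top (ENNReal.mul_ne_top (by norm_num)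
      (ENNReal.mul_ne_top h2 ENNReal.ofReal_ne_top))⟩⟩

theorem natCast_mul_rpow_mul (ha : 0 < a) (haα : a * α = 1) (S G : ℝ≥0∞) {N j : ℕ} (hN : N ≠ 0)
    (hj : j ≠ 0) :
    (N : ℝ≥0∞) * (ENNReal.ofReal ((j : ℝ) / N) *
      (S ^ α + (ENNReal.ofReal (((j : ℝ) / N) ^ (-a)) * G) ^ α)) =
      j * S ^ α + N * G ^ α := by
  have hN0 : (0 : ℝ) < N := by exact_mod_cast Nat.pos_of_ne_zero hN
  have hj0 : (0 : ℝ) < j := by exact_mod_cast Nat.pos_of_ne_zero hj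
  have hα : 0 < α := pos_of_mul_pos_right (by rw [haα]; exact one_pos) ha.le
  have e1 : (N : ℝ≥0∞) * ENNReal.ofReal ((j : ℝ) / N) = j := by
    rw [← ENNReal.ofReal_natCast, ← ENNReal.ofReal_mul hN0.le, mul_div_cancel₀ _ hN0.ne',
      ENNReal.ofReal_natCast]
  have e2 : (j : ℝ≥0∞) * ENNReal.ofReal (((j : ℝ) / N) ^ (-a)) ^ α = N := by
    rw [ENNReal.ofReal_rpow_of_nonneg (by positivity) hα.le, ← Real.rpow_mul (by positivity),
      neg_mul, haα, Real.rpow_neg_one, inv_div, ← ENNReal.ofReal_natCast,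
      ← ENNReal.ofReal_mul hj0.le, mul_div_cancel₀ _ hj0.ne', ENNReal.ofReal_natCast]
  rw [← mul_assoc, e1, mul_add, ENNReal.mul_rpow_of_nonneg _ _ hα.le, ← mul_assoc _ _ (G ^ α), e2]

theorem IsRINorm.le_mul_of_lintegral_le {Z : (ℝ → ℝ≥0∞) → ℝ≥0∞} (hZ : IsRINorm Z)
    (hf : Antitone f) (hf0 : f 0 ≠ ⊤) (hκ : 0 < κ) (ha : 0 < a) (hb : 0 < b)
    (hab : κ * a = a + κ * b) (haα : a * α = 1) (hα : 1 < α) {h : ℝ → ℝ≥0∞} (hh : Antitone h)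
    (hht : ∀ t, h t ≠ ⊤) {C : ℝ≥0∞} (hC : C ≠ ⊤)
    (hhf : ∀ t, 0 < t → ∫⁻ s in Ioo 0 t, h s ≤ C * (ENNReal.ofReal t *
      (outerInt κ b f t ^ α + (ENNReal.ofReal (t ^ (-a)) * innerInt κ a f t) ^ α))) :
    Z h ≤ C * gridConst κ a b α * Z fun t => outerInt κ b f t ^ α +
      outerInt κ b f t * (ENNReal.ofReal (t ^ (-a)) * innerInt κ a f t) ^ (α - 1) := by
  set S := outerInt κ b f with hS
  set G := innerInt κ a f with hG
  have hSa : AntitoneOn S (Ioi 0) := antitoneOn_outerInt hκ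
  have hGm : MonotoneOn G (Ici 0) := monotoneOn_innerInt hκ
  have hC' : C * gridConst κ a b α ≠ ⊤ := ENNReal.mul_ne_top hC (gridConst_ne_top hα)
  obtain ⟨M, hM⟩ := Filter.eventually_atTop.1
    ((eventually_two_pow_mul_innerInt_rpow_le hf hf0 hκ ha hb hab haα hα).and
      (Filter.eventually_ge_atTop 2))
  rw [hZ.eq_iSup_dyadic hh M]
  refine iSup_le fun L => ?_
  obtain ⟨hB, hL⟩ := hM (M + L) (by omega)
  have hN : 2 ^ (M + L) ≠ 0 := by positivity
  have hsum : ∀ j ≤ 2 ^ (M + L), ∑ i ∈ Finset.range j, h (((i : ℝ) + 1) / (2 ^ (M + L) : ℕ)) ≤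
      ∑ i ∈ Finset.range j, C * gridConst κ a b α * gridValue S G a α (2 ^ (M + L)) i := by
    intro j hj
    rcases eq_or_ne j 0 with rfl | hj0
    · simp
    have h1 := (sum_mul_ofReal_le_lintegral_Ioo hh (2 ^ (M + L)) j).trans
      (hhf _ (div_pos (by exact_mod_cast Nat.pos_of_ne_zero hj0) (by positivity)))
    have h2 := mul_add_mul_rpow_le_sum_gridValue ha haα hα hSa hGm
      (innerInt_ne_top hf hf0 ha) (fun t ht => innerInt_two_mul_le hf hκ ha ht)
      (fun t ht ht1 => innerInt_four_mul_le hf hκ ha hb hab ht ht1) hB hL hj0 hj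
    have h3 := mul_le_mul' (le_refl ((2 ^ (M + L) : ℕ) : ℝ≥0∞)) h1
    rw [mul_left_comm _ C, natCast_mul_rpow_mul ha haα _ _ hN hj0] at h3
    have h4 : ((2 ^ (M + L) : ℕ) : ℝ≥0∞) * ((∑ i ∈ Finset.range j,
        h (((i : ℝ) + 1) / (2 ^ (M + L) : ℕ))) * ENNReal.ofReal (1 / (2 ^ (M + L) : ℕ))) =
        ∑ i ∈ Finset.range j, h (((i : ℝ) + 1) / (2 ^ (M + L) : ℕ)) := by
      rw [mul_left_comm, ← ENNReal.ofReal_natCast, ← ENNReal.ofReal_mul (by positivity),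
        mul_one_div_cancel (by positivity), ENNReal.ofReal_one, mul_one]
    rw [h4] at h3
    rw [← Finset.mul_sum, mul_assoc]
    refine h3.trans (mul_le_mul' le_rfl (le_trans (le_of_eq ?_) h2))
    push_cast
    rfl
  have hkt : ∀ i, C * gridConst κ a b α * gridValue S G a α (2 ^ (M + L)) i ≠ ⊤ := fun i => by
    have h1 : S (((i : ℝ) + 1) / (2 ^ (M + L) : ℕ)) ≠ ⊤ :=
      outerInt_ne_top hf hf0 hb (by positivity)
    refine ENNReal.mul_ne_top hC' (ENNReal.add_ne_top.2
      ⟨ENNReal.rpow_ne_top_of_nonneg (by linarith) h1, ENNReal.mul_ne_top h1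
        (ENNReal.rpow_ne_top_of_nonneg (by linarith)
          (ENNReal.mul_ne_top ENNReal.ofReal_ne_top (innerInt_ne_top hf hf0 ha _)))⟩)
  have hha : Antitone fun i : ℕ => h (((i : ℝ) + 1) / (2 ^ (M + L) : ℕ)) := fun i j hij =>
    hh (by gcongr)
  have : NeZero (2 ^ (M + L)) := ⟨hN⟩
  refine (hZ.floor_le_of_sum_le hha (fun i => hht _) hkt hsum).trans ?_
  lift C * gridConst κ a b α to ℝ≥0 using hC' with c
  rw [← hZ.smul]
  refine hZ.mono _ _ ((ae_restrict_iff' measurableSet_Ioo).2 (.of_forall fun t ht => ?_))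
  exact mul_le_mul' le_rfl (gridValue_floor_le ha hα hSa hGm hN ht.1)

theorem rpow_mul_rpow_one_sub_rpow (haα : a * α = 1) (hα : 0 < α) (x y : ℝ≥0∞) :
    (x ^ a * y ^ (1 - a)) ^ α = x * y ^ (α - 1) := by
  rw [ENNReal.mul_rpow_of_nonneg _ _ hα.le, ← ENNReal.rpow_mul, ← ENNReal.rpow_mul, haα,
    ENNReal.rpow_one, show (1 - a) * α = α - 1 by linear_combination -haα]

end Comparison

theorem rearr_zero_measure {X : Type*} [MeasurableSpace X] (u : X → ℝ) (s : ℝ) :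
    rearr (0 : Measure X) u s = 0 :=
  le_antisymm (sInf_le (by simp)) zero_le

/-- **Reduction principle for slowly decaying measures (`0 < d < n-m`), second version:**
the Hardy-type inequalities for `S₁` and for the product operator
`(S₁f)^{1/α}(S₂f)^{1-1/α}`, `α = (n-d)/m`, in the norm `Z^{{α}}`, imply the Sobolev trace
inequality with target norm `Z^{{α}}`. -/
theorem reduction_principle_slow_second (n m : ℕ) (hn : 2 ≤ n) (hm : 1 ≤ m) (hmn : m < n)
    (d : ℝ) (hd0 : 0 < d) (hd : d < (n : ℝ) - m)
    (Ω : Set (EuclideanSpace ℝ (Fin n))) (hΩ : IsOpen Ω) (hΩvol : volume Ω < ⊤)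
    (NX NZ : (ℝ → ℝ≥0∞) → ℝ≥0∞) (hX : IsRINorm NX) (hZ : IsRINorm NZ)
    (μ : Measure (EuclideanSpace ℝ (Fin n))) (hfin : IsFiniteMeasure μ) (hsupp : μ Ωᶜ = 0)
    (hFrostman : ∃ A : ℝ, ∀ (x : EuclideanSpace ℝ (Fin n)) (r : ℝ), 0 < r →
        μ (Metric.ball x r ∩ Ω) ≤ ENNReal.ofReal (A * r ^ d))
    (C₁ : ℝ)
    (hHardy1 : ∀ f : ℝ → ℝ≥0∞, Measurable f → AntitoneOn f (Set.Ioo 0 1) →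
        (NZ (fun t => (S1 n m d f t) ^ (((n : ℝ) - d) / m))) ^ ((m : ℝ) / ((n : ℝ) - d)) ≤
          ENNReal.ofReal C₁ * NX f)
    (hHardy2 : ∀ f : ℝ → ℝ≥0∞, Measurable f → AntitoneOn f (Set.Ioo 0 1) →
        (NZ (fun t => ((S1 n m d f t) ^ ((m : ℝ) / ((n : ℝ) - d)) *
              (S2 n m d f t) ^ (1 - (m : ℝ) / ((n : ℝ) - d))) ^ (((n : ℝ) - d) / m))) ^
            ((m : ℝ) / ((n : ℝ) - d)) ≤
          ENNReal.ofReal C₁ * NX f) :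
    ∃ C₂ : ℝ, ∀ u : EuclideanSpace ℝ (Fin n) → ℝ,
      ContDiff ℝ (⊤ : ℕ∞) u → HasCompactSupport u → tsupport u ⊆ Ω →
      (NZ (fun t => (rearr μ u ((μ Ω).toReal * t)) ^ (((n : ℝ) - d) / m))) ^
          ((m : ℝ) / ((n : ℝ) - d)) ≤
        ENNReal.ofReal C₂ *
          NX (fun t => rearr (volume.restrict Ω) (fun x => ‖iteratedFDeriv ℝ m u x‖)
            ((volume Ω).toReal * t)) := by
  obtain ⟨A, hA⟩ := hFrostman
  have hm0 : (0 : ℝ) < m := by exact_mod_cast hm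
  have hn0 : (0 : ℝ) < n := by exact_mod_cast (by omega : 0 < n)
  have hnd : 0 < (n : ℝ) - d := by linarith
  set a := (m : ℝ) / (n - d) with ha
  set α := ((n : ℝ) - d) / m with hα
  have ha0 : 0 < a := div_pos hm0 hnd
  have hα1 : 1 < α := by rw [hα, lt_div_iff₀ hm0]; linarith
  have hα0 : 0 < α := by linarith
  have haα : a * α = 1 := by rw [ha, hα]; field_simp
  have ha1 : a ≤ 1 := by rw [ha, div_le_one hnd]; linarith
  set P := (μ Ω).toReal with hP
  rcases (ENNReal.toReal_nonneg : 0 ≤ P).eq_or_lt with hP0 | hP0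
  · have hμ0 : μ = 0 := by
      have h1 : μ Ω = 0 := by
        rcases (ENNReal.toReal_eq_zero_iff _).1 (hP ▸ hP0.symm) with h | h
        · exact h
        · exact absurd h (measure_ne_top μ Ω)
      rw [← Measure.measure_univ_eq_zero, ← union_compl_self Ω]
      exact measure_union_null h1 hsupp
    refine ⟨0, fun u _ _ _ => ?_⟩
    have : NZ (fun t => rearr μ u (P * t) ^ α) = 0 := by
      refine (hZ.eq_zero_iff _).2 (.of_forall fun t => ?_)
      rw [hμ0, rearr_zero_measure, ENNReal.zero_rpow_of_pos hα0]
    rw [this, ENNReal.zero_rpow_of_pos ha0]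
    exact zero_le
  have hΩ0 : volume Ω ≠ 0 := by
    have hne : Ω.Nonempty := nonempty_of_measure_ne_zero (μ := μ) fun h => by
      rw [h, ENNReal.toReal_zero] at hP0
      exact lt_irrefl _ hP0
    exact (hΩ.measure_pos volume hne).ne'
  have hball : ∀ (x : EuclideanSpace ℝ (Fin n)) (r : ℝ), 0 < r →
      μ (Metric.ball x r) ≤ ENNReal.ofReal (max A 0 * r ^ d) := fun x r hr => by
    rw [← measure_inter_add_sdiff₀ (μ := μ) (Metric.ball x r) hΩ.measurableSet.nullMeasurableSet,
      measure_mono_null (s := Metric.ball x r \ Ω) (fun y hy => hy.2) hsupp, add_zero]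
    refine (hA x r hr).trans (ENNReal.ofReal_le_ofReal ?_)
    gcongr
    exact le_max_left _ _
  obtain ⟨C, hC, hCu⟩ := exists_lintegral_rearr_rpow_le hm hmn hn hd0 hd hΩvol hΩ0 μ
    (le_max_right A 0) hball hP0
  set κ := (n : ℝ) / d with hκ
  set b := (m : ℝ) / n with hb
  have hκ0 : 0 < κ := div_pos hn0 hd0
  have hb0 : 0 < b := div_pos hm0 hn0
  have hab : κ * a = a + κ * b := by
    rw [hκ, ha, hb]
    field_simp
    ring
  have hg : (C * gridConst κ a b α) ^ a ≠ ⊤ :=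
    ENNReal.rpow_ne_top_of_nonneg ha0.le (ENNReal.mul_ne_top hC (gridConst_ne_top hα1))
  refine ⟨((C * gridConst κ a b α) ^ a * (2 * ENNReal.ofReal C₁)).toReal, fun u hu hcu hsu => ?_⟩
  rw [ENNReal.ofReal_toReal (ENNReal.mul_ne_top hg
    (ENNReal.mul_ne_top (by norm_num) ENNReal.ofReal_ne_top))]
  set f : ℝ → ℝ≥0∞ := fun s => rearr (volume.restrict Ω) (fun x => ‖iteratedFDeriv ℝ m u x‖)
    ((volume Ω).toReal * s) with hf
  have hfa : Antitone f := fun s t hst =>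
    rearr_antitone _ (mul_le_mul_of_nonneg_left hst ENNReal.toReal_nonneg)
  have hf0 : f 0 ≠ ⊤ := by
    obtain ⟨M, hM⟩ := (hu.continuous_iteratedFDeriv (m := m)
      (by exact_mod_cast le_top)).bounded_above_of_compact_support (hcu.iteratedFDeriv (𝕜 := ℝ) m)
    exact ne_top_of_le_ne_top ENNReal.ofReal_ne_top
      (rearr_le_of_forall_le (M := M) (fun x => by simpa using hM x) _)
  have hh : Antitone fun t => rearr μ u (P * t) ^ α := fun s t hst =>
    ENNReal.rpow_le_rpow (rearr_antitone _ (mul_le_mul_of_nonneg_left hst hP0.le)) hα0.le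
  have hht : ∀ t, rearr μ u (P * t) ^ α ≠ ⊤ := fun t => by
    obtain ⟨M, hM⟩ := hu.continuous.bounded_above_of_compact_support hcu
    exact ENNReal.rpow_ne_top_of_nonneg hα0.le (ne_top_of_le_ne_top ENNReal.ofReal_ne_top
      (rearr_le_of_forall_le (M := M) hM _))
  have hmain : NZ (fun t => rearr μ u (P * t) ^ α) ≤ C * gridConst κ a b α *
      NZ fun t => S1 n m d f t ^ α + S1 n m d f t * S2 n m d f t ^ (α - 1) :=
    hZ.le_mul_of_lintegral_le hfa hf0 hκ0 ha0 hb0 hab haα hα1 hh hht hC (hCu u hu hcu hsu f hf)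
  have h1 := hHardy1 f hfa.measurable (hfa.antitoneOn _)
  have h2 := hHardy2 f hfa.measurable (hfa.antitoneOn _)
  simp only [rpow_mul_rpow_one_sub_rpow haα hα0] at h2
  calc NZ (fun t => rearr μ u (P * t) ^ α) ^ a
      ≤ (C * gridConst κ a b α * (NZ (fun t => S1 n m d f t ^ α) +
          NZ fun t => S1 n m d f t * S2 n m d f t ^ (α - 1))) ^ a :=
        ENNReal.rpow_le_rpow (hmain.trans (mul_le_mul' le_rfl (hZ.add_le _ _))) ha0.le
    _ ≤ (C * gridConst κ a b α) ^ a * (NZ (fun t => S1 n m d f t ^ α) ^ a +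
          NZ (fun t => S1 n m d f t * S2 n m d f t ^ (α - 1)) ^ a) := by
        rw [ENNReal.mul_rpow_of_nonneg _ _ ha0.le]
        exact mul_le_mul' le_rfl (ENNReal.rpow_add_le_add_rpow _ _ ha0.le ha1)
    _ ≤ (C * gridConst κ a b α) ^ a * (ENNReal.ofReal C₁ * NX f + ENNReal.ofReal C₁ * NX f) := by
        gcongr
    _ = _ := by ring
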